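/- arXiv:1212.3689 — 4 statements merged into one kernel-verified Lean document; each statement's English description precedes it below -/
import Mathlib

section
/- Let I be a finite set, let Q and P_i (for i ∈ I) be probability distributions on a finite set Z such that Q(z) > 0 whenever P_i(z) > 0 for some i. Let (i_1, …, i_n) ∈ I^n, and define D_n := (1/n)·Σ_{k=1}^n D(P_{i_k}‖Q), V_n := (1/n)·Σ_{k=1}^n V(P_{i_k}‖Q), and T_n := (1/n)·Σ_{k=1}^n T(P_{i_k}‖Q). If V_n > 0, then for every ε ∈ (0,1), D_s^ε(P_{i_1} × ⋯ × P_{i_n} ‖ Q^{×n}) ≤ n·D_n + √(n·V_n)·Φ⁻¹( ε + 6·T_n/√(n·V_n³) ), where P_{i_1} × ⋯ × P_{i_n} is the product distribution on Z^n and Q^{×n} is the n-fold product of Q. -/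
open Finset MeasureTheory

/-- `P` is a probability distribution on the finite set `Z`. -/
def IsDist {Z : Type*} [Fintype Z] (P : Z → ℝ) : Prop :=
  (∀ z, 0 ≤ P z) ∧ ∑ z, P z = 1

/-- `W` is a (discrete memoryless) channel from `X` to `Y`: a stochastic matrix. -/
def IsChannel {X Y : Type*} [Fintype X] [Fintype Y] (W : X → Y → ℝ) : Prop :=
  ∀ x, IsDist (W x)

/-- Relative entropy `D(P‖Q) = Σ_z P(z) log (P(z)/Q(z))`. -/
noncomputable def relEnt {Z : Type*} [Fintype Z] (P Q : Z → ℝ) : ℝ :=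
  ∑ z, P z * Real.log (P z / Q z)

/-- Divergence variance `V(P‖Q)`. -/
noncomputable def divVar {Z : Type*} [Fintype Z] (P Q : Z → ℝ) : ℝ :=
  ∑ z, P z * (Real.log (P z / Q z) - relEnt P Q) ^ 2

/-- Standard normal cumulative distribution function `Φ`. -/
noncomputable def stdPhi (a : ℝ) : ℝ :=
  ∫ x in Set.Iic a, Real.exp (-(x ^ 2) / 2) / Real.sqrt (2 * Real.pi)

/-- `Φ⁻¹(ε) = sup {a | Φ(a) ≤ ε}`. -/
noncomputable def PhiInv (ε : ℝ) : ℝ :=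
  sSup {a : ℝ | stdPhi a ≤ ε}

/-- Relative entropy information spectrum divergence `D_s^ε(P‖Q)`, as an extended real:
the supremum of all `R` with `P[log(P/Q) ≤ R] ≤ ε`, where `log(P(z)/Q(z)) = -∞` when
`P z = 0` and `+∞` when `P z > 0 = Q z`. -/
noncomputable def Ds {Z : Type*} [Fintype Z] (ε : ℝ) (P Q : Z → ℝ) : EReal :=
  sSup ((fun R : ℝ => (R : EReal)) ''
    {R : ℝ | ∑ z, (if P z = 0 ∨ (0 < Q z ∧ Real.log (P z / Q z) ≤ R) then P z else 0) ≤ ε})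

/-- Third absolute moment of the log-likelihood ratio `T(P‖Q)`. -/
noncomputable def divThird {Z : Type*} [Fintype Z] (P Q : Z → ℝ) : ℝ :=
  ∑ z, P z * |Real.log (P z / Q z) - relEnt P Q| ^ 3

/-- `Φ⁻¹` as an extended real, taking the values `±∞` outside `(0,1)`. -/
noncomputable def PhiInvE (ε : ℝ) : EReal :=
  sSup ((fun a : ℝ => (a : EReal)) '' {a : ℝ | stdPhi a ≤ ε})

/-- The Fejér kernel on the real line. -/
noncomputable def fejer (y : ℝ) : ℝ :=
  Real.pi⁻¹ * ∫ u in (0 : ℝ)..1, (1 - u) * Real.cos (u * y)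

/-- The primitive of the Fejér kernel vanishing at the origin. -/
noncomputable def fejerPrim (s : ℝ) : ℝ :=
  Real.pi⁻¹ * ∫ u in (0 : ℝ)..1, (1 - u) * (Real.sin (u * s) / u)

lemma continuous_fejer : Continuous fejer := by
  unfold fejer
  refine continuous_const.mul ?_
  exact intervalIntegral.continuous_parametric_intervalIntegral_of_continuous' (by fun_prop) 0 1

lemma fejer_neg (y : ℝ) : fejer (-y) = fejer y := by
  simp [fejer]

lemma fejer_eq {y : ℝ} (hy : y ≠ 0) : fejer y = (1 - Real.cos y) / (Real.pi * y ^ 2) := by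
  have h : ∫ u in (0 : ℝ)..1, (1 - u) * Real.cos (u * y) = (1 - Real.cos y) / y ^ 2 := by
    have hd : ∀ u ∈ Set.uIcc (0 : ℝ) 1, HasDerivAt
        (fun u => (1 - u) * Real.sin (u * y) / y - Real.cos (u * y) / y ^ 2)
        ((1 - u) * Real.cos (u * y)) u := by
      intro u _
      have h1 : HasDerivAt (fun u : ℝ => u * y) y u := by
        simpa using (hasDerivAt_id u).mul_const y
      have h2 : HasDerivAt (fun u : ℝ => 1 - u) (-1) u := by
        simpa using (hasDerivAt_id u).const_sub 1
      refine (((h2.mul h1.sin).div_const y).sub (h1.cos.div_const (y ^ 2))).congr_deriv ?_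
      field_simp
      ring
    rw [intervalIntegral.integral_eq_sub_of_hasDerivAt hd
      (Continuous.intervalIntegrable (by fun_prop) _ _)]
    simp
    ring
  rw [fejer, h]
  field_simp

lemma fejer_nonneg (y : ℝ) : 0 ≤ fejer y := by
  rcases eq_or_ne y 0 with rfl | hy
  · refine mul_nonneg (by positivity) ?_
    refine intervalIntegral.integral_nonneg zero_le_one fun u hu => ?_
    simp [hu.2]
  · rw [fejer_eq hy]
    have := Real.cos_le_one y
    have := Real.pi_pos
    exact div_nonneg (by linarith) (by positivity)

lemma fejer_le {y : ℝ} (hy : y ≠ 0) : fejer y ≤ 2 / Real.pi * y ^ (-2 : ℝ) := by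
  have := Real.neg_one_le_cos y
  have := Real.pi_pos
  have h2 : (y : ℝ) ^ (-2 : ℝ) = (y ^ 2)⁻¹ := by
    rw [show (-2 : ℝ) = ((-2 : ℤ) : ℝ) by norm_num, Real.rpow_intCast]
    rfl
  rw [fejer_eq hy, h2, ← div_eq_mul_inv, div_div]
  gcongr
  linarith

lemma integrableOn_fejer_Ioi {h : ℝ} (hh : 0 < h) : IntegrableOn fejer (Set.Ioi h) := by
  refine ((integrableOn_Ioi_rpow_of_lt (a := -2) (by norm_num) hh).const_mul (2 / Real.pi)).mono'
    continuous_fejer.aestronglyMeasurable ?_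
  filter_upwards [ae_restrict_mem measurableSet_Ioi] with y hy
  rw [Real.norm_of_nonneg (fejer_nonneg y)]
  exact fejer_le (hh.trans hy).ne'

lemma setIntegral_fejer_Ioi_le {h : ℝ} (hh : 0 < h) :
    ∫ y in Set.Ioi h, fejer y ≤ 2 / (Real.pi * h) := by
  have hi := (integrableOn_Ioi_rpow_of_lt (a := -2) (by norm_num) hh)
  calc ∫ y in Set.Ioi h, fejer y ≤ ∫ y in Set.Ioi h, 2 / Real.pi * y ^ (-2 : ℝ) :=
        setIntegral_mono_on (integrableOn_fejer_Ioi hh) (hi.const_mul _) measurableSet_Ioi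
          fun y hy => fejer_le (hh.trans hy).ne'
    _ = 2 / (Real.pi * h) := by
        rw [integral_const_mul, integral_Ioi_rpow_of_lt (by norm_num) hh]
        norm_num
        rw [Real.rpow_neg_one]
        have := Real.pi_pos
        field_simp

lemma integrable_fejer : Integrable fejer := by
  have h1 : IntegrableOn fejer (Set.Ioi 0) := by
    have : Set.Ioi (0:ℝ) = Set.Ioc 0 1 ∪ Set.Ioi 1 := by simp
    rw [this]
    exact (continuous_fejer.integrableOn_Ioc).union (integrableOn_fejer_Ioi one_pos)
  have h2 : IntegrableOn fejer (Set.Iic 0) := by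
    rw [← integrableOn_Ici_iff_integrableOn_Ioi] at h1
    have := h1.comp_neg
    simpa [fejer_neg] using this
  have := h2.union h1
  simpa using this

open FourierTransform in
lemma fourier_tent (y : ℝ) : 𝓕 (fun x : ℝ => ((max (1 - |x|) 0 : ℝ) : ℂ)) y =
    ((2 * Real.pi * fejer (2 * Real.pi * y) : ℝ) : ℂ) := by
  set g : ℝ → ℂ := fun x => Complex.exp (↑(-2 * Real.pi * x * y) * Complex.I) *
    ((max (1 - |x|) 0 : ℝ) : ℂ) with hg
  have hgc : Continuous g := by fun_prop
  have hgs : HasCompactSupport g := by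
    refine HasCompactSupport.intro (isCompact_Icc (a := (-1 : ℝ)) (b := 1)) fun x hx => ?_
    have : 1 ≤ |x| := by
      by_contra! h
      exact hx ⟨(abs_lt.1 h).1.le, (abs_lt.1 h).2.le⟩
    simp [hg, max_eq_right (sub_nonpos.2 this)]
  have hgi : Integrable g := hgc.integrable_of_hasCompactSupport hgs
  rw [Real.fourier_real_eq_integral_exp_smul]
  simp only [smul_eq_mul]
  change ∫ x, g x = _
  have hneg : ∫ x in Set.Iic (0 : ℝ), g x = ∫ x in Set.Ioi (0 : ℝ), g (-x) := by
    simp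
  rw [← integral_add_compl (measurableSet_Ioi (a := (0 : ℝ))) hgi, Set.compl_Ioi, hneg,
    ← integral_add hgi.integrableOn hgi.comp_neg.integrableOn]
  have hsum : ∀ x ∈ Set.Ioi (0 : ℝ), g x + g (-x) =
      ((2 * (max (1 - x) 0 * Real.cos (x * (2 * Real.pi * y))) : ℝ) : ℂ) := by
    intro x hx
    simp only [hg, abs_neg, abs_of_pos (Set.mem_Ioi.1 hx)]
    push_cast
    rw [Complex.cos]
    ring_nf
  rw [setIntegral_congr_fun measurableSet_Ioi hsum, integral_complex_ofReal, integral_const_mul,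
    setIntegral_eq_of_subset_of_forall_sdiff_eq_zero (s := Set.Ioc 0 1) measurableSet_Ioi
      (fun x hx => hx.1) ?_]
  · congr 1
    rw [fejer, intervalIntegral.integral_of_le zero_le_one,
      setIntegral_congr_fun (g := fun u => (1 - u) * Real.cos (u * (2 * Real.pi * y)))
      measurableSet_Ioc fun x hx => ?_]
    · rw [← mul_assoc (2 * Real.pi), mul_inv_cancel_right₀ Real.pi_ne_zero]
    · simp only [max_eq_left (sub_nonneg.2 hx.2)]
  · intro x hx
    have : 1 < x := by
      by_contra! h
      exact hx.2 ⟨hx.1, h⟩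
    simp [max_eq_right (sub_nonpos.2 this.le)]

open FourierTransform in
lemma integral_fejer : ∫ y, fejer y = 1 := by
  set f : ℝ → ℂ := fun x : ℝ => ((max (1 - |x|) 0 : ℝ) : ℂ) with hf
  have hfc : Continuous f := by fun_prop
  have hfs : HasCompactSupport f := by
    refine HasCompactSupport.intro (isCompact_Icc (a := (-1 : ℝ)) (b := 1)) fun x hx => ?_
    have : 1 ≤ |x| := by
      by_contra! h
      exact hx ⟨(abs_lt.1 h).1.le, (abs_lt.1 h).2.le⟩
    simp [hf, max_eq_right (sub_nonpos.2 this)]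
  have hpi : 2 * Real.pi ≠ 0 := by positivity
  have hF : 𝓕 f = fun y => ((2 * Real.pi * fejer (2 * Real.pi * y) : ℝ) : ℂ) :=
    funext fourier_tent
  have hFi : Integrable (𝓕 f) := by
    rw [hF]
    exact ((integrable_fejer.comp_mul_left' hpi).const_mul _).ofReal
  have h := (hfc.integrable_of_hasCompactSupport hfs).fourierInv_fourier_eq hFi
    (hfc.continuousAt (x := 0))
  rw [Real.fourierInv_eq', hF] at h
  simp only [inner_zero_right, mul_zero, Complex.ofReal_zero, zero_mul, Complex.exp_zero,
    one_smul] at h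
  rw [integral_complex_ofReal, integral_const_mul, Measure.integral_comp_mul_left] at h
  simp only [hf, abs_zero, sub_zero, smul_eq_mul, abs_inv, abs_of_pos Real.two_pi_pos] at h
  rw [← mul_assoc, mul_inv_cancel₀ hpi] at h
  simpa using h

lemma integral_fejer_Ioi_zero : ∫ y in Set.Ioi 0, fejer y = 1 / 2 := by
  have h := integral_comp_neg_Ioi (0 : ℝ) fejer
  simp only [fejer_neg, neg_zero] at h
  have h2 := integral_add_compl (measurableSet_Ioi (a := (0 : ℝ))) integrable_fejer
  rw [integral_fejer, Set.compl_Ioi, ← h] at h2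
  linarith

lemma integral_fejer_interval (s : ℝ) : ∫ y in (0 : ℝ)..s, fejer y = fejerPrim s := by
  unfold fejer fejerPrim
  rw [intervalIntegral.integral_const_mul, intervalIntegral_intervalIntegral_swap]
  · congr 1
    refine intervalIntegral.integral_congr_ae ?_
    filter_upwards with u hu
    rw [Set.uIoc_of_le zero_le_one] at hu
    rw [intervalIntegral.integral_const_mul, intervalIntegral.integral_comp_mul_left _ hu.1.ne',
      integral_cos]
    simp only [mul_zero, Real.sin_zero, sub_zero, smul_eq_mul]
    ring
  · refine IntegrableOn.mono_set (t := Set.uIcc 0 s ×ˢ Set.uIcc 0 1) ?_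
      (Set.prod_mono Set.uIoc_subset_uIcc Set.uIoc_subset_uIcc)
    refine ContinuousOn.integrableOn_compact (isCompact_uIcc.prod isCompact_uIcc) ?_
    exact Continuous.continuousOn (by fun_prop)

lemma integral_fejer_Ioi (s : ℝ) : ∫ y in Set.Ioi s, fejer y = 1 / 2 - fejerPrim s := by
  rw [← integral_fejer_interval, ← integral_fejer_Ioi_zero]
  have := intervalIntegral.integral_Ioi_sub_Ioi' (a := 0) (b := s) (μ := volume) (f := fejer) 
    integrable_fejer.integrableOn integrable_fejer.integrableOn
  linarith

lemma continuous_fejerPrim : Continuous fejerPrim := by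
  have : fejerPrim = fun s => ∫ y in (0 : ℝ)..s, fejer y := by
    ext s
    rw [integral_fejer_interval]
  rw [this]
  exact intervalIntegral.continuous_primitive (fun a b => continuous_fejer.intervalIntegrable a b) 0

lemma abs_fejerPrim_le (s : ℝ) : |fejerPrim s| ≤ 1 / 2 := by
  have h := integral_fejer_Ioi s
  have h0 : 0 ≤ ∫ y in Set.Ioi s, fejer y := integral_nonneg fejer_nonneg
  have h1 : ∫ y in Set.Ioi s, fejer y ≤ ∫ y, fejer y :=
    setIntegral_le_integral integrable_fejer (Filter.Eventually.of_forall fejer_nonneg)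
  rw [integral_fejer] at h1
  rw [abs_le]
  constructor <;> linarith

lemma integrable_fejerPrim_comp (μ : Measure ℝ) [IsProbabilityMeasure μ] (T t : ℝ) :
    Integrable (fun s => fejerPrim (T * (s - t))) μ := by
  refine Integrable.of_bound (C := 1 / 2)
    (continuous_fejerPrim.comp (by fun_prop)).aestronglyMeasurable ?_
  exact Filter.Eventually.of_forall fun s => abs_fejerPrim_le _

lemma integral_cdf_mul_fejer (μ : Measure ℝ) [IsProbabilityMeasure μ] {T : ℝ} (hT : 0 < T)
    (t : ℝ) : ∫ y, μ.real (Set.Iic (t + y / T)) * fejer y =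
      1 / 2 - ∫ s, fejerPrim (T * (s - t)) ∂μ := by
  have hS : MeasurableSet {p : ℝ × ℝ | p.2 ≤ t + p.1 / T} :=
    measurableSet_le (by fun_prop) (by fun_prop)
  have hint : Integrable (Function.uncurry fun y s : ℝ =>
      {p : ℝ × ℝ | p.2 ≤ t + p.1 / T}.indicator (fun p => fejer p.1) (y, s))
      ((volume : Measure ℝ).prod μ) := by
    exact (integrable_fejer.comp_fst μ).indicator hS
  calc ∫ y, μ.real (Set.Iic (t + y / T)) * fejer y
      = ∫ y, ∫ s, {p : ℝ × ℝ | p.2 ≤ t + p.1 / T}.indicator (fun p => fejer p.1) (y, s) ∂μ := by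
        congr 1 with y
        rw [← smul_eq_mul, ← integral_indicator_const _ measurableSet_Iic]
        rfl
    _ = ∫ s, (∫ y, {p : ℝ × ℝ | p.2 ≤ t + p.1 / T}.indicator (fun p => fejer p.1) (y, s)) ∂μ :=
        integral_integral_swap hint
    _ = ∫ s, (1 / 2 - fejerPrim (T * (s - t))) ∂μ := by
        congr 1 with s
        rw [← integral_fejer_Ioi, ← integral_Ici_eq_integral_Ioi,
          ← integral_indicator measurableSet_Ici]
        congr 1 with y
        have : s ≤ t + y / T ↔ T * (s - t) ≤ y := by
          rw [← sub_le_iff_le_add', le_div_iff₀' hT]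
        simp [Set.indicator_apply, this]
    _ = _ := by
        rw [integral_sub (integrable_const _) (integrable_fejerPrim_comp μ T t)]
        simp

lemma integral_sin_eq_im (μ : Measure ℝ) [IsProbabilityMeasure μ] (t v : ℝ) :
    ∫ s, Real.sin (v * (s - t)) ∂μ =
      (Complex.exp (-(v * t) * Complex.I) * charFun μ v).im := by
  rw [charFun_apply_real, ← integral_const_mul]
  have : Integrable (fun s : ℝ => Complex.exp (-(v * t) * Complex.I) *
      Complex.exp (v * s * Complex.I)) μ := by
    refine Integrable.of_bound (C := 1) (by fun_prop) (Filter.Eventually.of_forall fun s => ?_)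
    rw [← Complex.exp_add, ← add_mul]
    norm_cast
    rw [Complex.norm_exp_ofReal_mul_I]
  have h := integral_im this
  simp only [RCLike.im_to_complex] at h
  rw [← h]
  congr 1 with s
  rw [← Complex.exp_add, ← add_mul]
  norm_cast
  rw [Complex.exp_ofReal_mul_I_im]
  ring_nf

lemma integrable_fejerPrim_integrand (μ : Measure ℝ) [IsProbabilityMeasure μ]
    (hμ : Integrable id μ) (T t : ℝ) :
    Integrable (Function.uncurry fun s u : ℝ => (1 - u) * (Real.sin (u * (T * (s - t))) / u))
      (μ.prod (volume.restrict (Set.Ioc (0 : ℝ) 1))) := by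
  have hdom : Integrable (fun p : ℝ × ℝ => |T| * |p.1 - t|)
      (μ.prod (volume.restrict (Set.Ioc (0 : ℝ) 1))) := by
    have : Integrable (fun s : ℝ => |T| * |s - t|) μ :=
      ((hμ.sub (integrable_const t)).abs).const_mul _
    exact this.comp_fst _
  refine hdom.mono' (Measurable.aestronglyMeasurable (by unfold Function.uncurry; fun_prop)) ?_
  have hmem : ∀ᵐ p ∂(μ.prod (volume.restrict (Set.Ioc (0 : ℝ) 1))), p.2 ∈ Set.Ioc (0 : ℝ) 1 :=
    Measure.quasiMeasurePreserving_snd.ae (ae_restrict_mem measurableSet_Ioc)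
  filter_upwards [hmem] with p hp
  obtain ⟨hp0, hp1⟩ := hp
  simp only [Function.uncurry, norm_mul, norm_div, Real.norm_eq_abs]
  have h1 : |1 - p.2| ≤ 1 := by rw [abs_le]; constructor <;> linarith
  have h2 : |Real.sin (p.2 * (T * (p.1 - t)))| / |p.2| ≤ |T| * |p.1 - t| := by
    rw [div_le_iff₀ (abs_pos.2 hp0.ne')]
    refine Real.abs_sin_le_abs.trans_eq ?_
    rw [abs_mul, abs_mul]
    ring
  calc _ ≤ 1 * (|T| * |p.1 - t|) := by gcongr
    _ = _ := one_mul _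

lemma integral_fejerPrim_comp (μ : Measure ℝ) [IsProbabilityMeasure μ] (hμ : Integrable id μ)
    (T t : ℝ) : ∫ s, fejerPrim (T * (s - t)) ∂μ = Real.pi⁻¹ * ∫ u in (0 : ℝ)..1,
      (1 - u) * ((Complex.exp (-(↑(u * T) * t) * Complex.I) * charFun μ (u * T)).im / u) := by
  unfold fejerPrim
  simp_rw [intervalIntegral.integral_of_le zero_le_one]
  rw [integral_const_mul, integral_integral_swap (integrable_fejerPrim_integrand μ hμ T t)]
  congr 2 with u
  rw [integral_const_mul, integral_div, ← integral_sin_eq_im]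
  simp only [mul_assoc]

lemma intervalIntegrable_im_charFun (μ : Measure ℝ) [IsProbabilityMeasure μ]
    (hμ : Integrable id μ) (T t : ℝ) : IntervalIntegrable (fun u : ℝ =>
      (1 - u) * ((Complex.exp (-(↑(u * T) * t) * Complex.I) * charFun μ (u * T)).im / u))
      volume 0 1 := by
  rw [intervalIntegrable_iff_integrableOn_Ioc_of_le zero_le_one]
  refine (integrable_fejerPrim_integrand μ hμ T t).integral_prod_right.congr ?_
  filter_upwards with u
  simp only [Function.uncurry]
  rw [integral_const_mul, integral_div, ← integral_sin_eq_im]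
  simp only [mul_assoc]

lemma abs_integral_cdf_sub_mul_fejer_le (μ ν : Measure ℝ) [IsProbabilityMeasure μ]
    [IsProbabilityMeasure ν] (hμ : Integrable id μ) (hν : Integrable id ν) {T : ℝ} (hT : 0 < T)
    {b : ℝ → ℝ} (hb : IntervalIntegrable b volume 0 1)
    (hle : ∀ u ∈ Set.Ioc (0 : ℝ) 1, ‖charFun μ (u * T) - charFun ν (u * T)‖ ≤ u * b u) (t : ℝ) :
    |∫ y, (ν.real (Set.Iic (t + y / T)) - μ.real (Set.Iic (t + y / T))) * fejer y| ≤
      Real.pi⁻¹ * ∫ u in (0 : ℝ)..1, b u := by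
  have hint (ρ : Measure ℝ) [IsProbabilityMeasure ρ] :
      Integrable fun y => ρ.real (Set.Iic (t + y / T)) * fejer y := by
    refine integrable_fejer.bdd_mul (c := 1) ?_ ?_
    · have hm : Monotone fun y => ρ.real (Set.Iic (t + y / T)) := fun y z hyz =>
        measureReal_mono (Set.Iic_subset_Iic.2 (by gcongr))
      exact hm.measurable.aestronglyMeasurable
    · filter_upwards with y
      rw [Real.norm_of_nonneg measureReal_nonneg]
      exact measureReal_le_one
  simp_rw [sub_mul]
  rw [integral_sub (hint ν) (hint μ), integral_cdf_mul_fejer ν hT, integral_cdf_mul_fejer μ hT,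
    integral_fejerPrim_comp μ hμ, integral_fejerPrim_comp ν hν, sub_sub_sub_cancel_left,
    ← mul_sub, abs_mul, abs_of_pos (inv_pos.2 Real.pi_pos),
    ← intervalIntegral.integral_sub (intervalIntegrable_im_charFun μ hμ T t)
      (intervalIntegrable_im_charFun ν hν T t)]
  have := Real.pi_pos
  gcongr
  rw [← Real.norm_eq_abs]
  refine intervalIntegral.norm_integral_le_of_norm_le zero_le_one ?_ hb
  filter_upwards with u hu
  rw [← mul_sub, ← sub_div, ← Complex.sub_im, ← mul_sub, norm_mul, norm_div, Real.norm_eq_abs,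
    Real.norm_eq_abs, Real.norm_of_nonneg hu.1.le, abs_of_nonneg (sub_nonneg.2 hu.2)]
  have h1 : |(Complex.exp (-(↑(u * T) * t) * Complex.I) *
      (charFun μ (u * T) - charFun ν (u * T))).im| ≤ u * b u := by
    refine (Complex.abs_im_le_norm _).trans ?_
    rw [norm_mul]
    have : ‖Complex.exp (-(↑(u * T) * t) * Complex.I)‖ = 1 := by
      norm_cast
      exact Complex.norm_exp_ofReal_mul_I _
    rw [this, one_mul]
    exact hle u hu
  have h2 := (div_le_iff₀' hu.1).2 h1
  have h3 := (div_nonneg (abs_nonneg _) hu.1.le).trans h2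
  refine (mul_le_mul_of_nonneg_left h2 (sub_nonneg.2 hu.2)).trans ?_
  nlinarith [hu.1]

lemma setIntegral_fejer_compl_Icc_le {h : ℝ} (hh : 0 < h) :
    ∫ y in (Set.Icc (-h) h)ᶜ, fejer y ≤ 4 / (Real.pi * h) := by
  have hset : (Set.Icc (-h) h)ᶜ = Set.Iio (-h) ∪ Set.Ioi h := by
    ext y
    simp only [Set.mem_compl_iff, Set.mem_Icc, Set.mem_union, Set.mem_Iio, Set.mem_Ioi]
    rw [not_and_or, not_le, not_le]
  have hdisj : Disjoint (Set.Iio (-h)) (Set.Ioi h) :=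
    Set.disjoint_left.2 fun y hy hy' => by
      simp only [Set.mem_Iio, Set.mem_Ioi] at hy hy'
      linarith
  have hneg : ∫ y in Set.Iio (-h), fejer y = ∫ y in Set.Ioi h, fejer y := by
    rw [← integral_Iic_eq_integral_Iio, ← integral_comp_neg_Ioi]
    simp only [fejer_neg]
  rw [hset, setIntegral_union hdisj measurableSet_Ioi integrable_fejer.integrableOn
    integrable_fejer.integrableOn, hneg]
  have := setIntegral_fejer_Ioi_le hh
  have h4 : 4 / (Real.pi * h) = 2 / (Real.pi * h) + 2 / (Real.pi * h) := by ring
  linarith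

lemma integral_mul_fejer_ge {g : ℝ → ℝ} (hg : Measurable g) {η A m : ℝ}
    (hη : ∀ y, |g y| ≤ η) (hA : -η ≤ A)
    (hlow : ∀ y ∈ Set.Icc (-(16 / Real.pi)) (16 / Real.pi), A + m * y ≤ g y) :
    A - (η + A) / 4 ≤ ∫ y, g y * fejer y := by
  set h := 16 / Real.pi with hh
  have hpi := Real.pi_pos
  have hpos : 0 < h := by positivity
  have hodd : ∫ y in Set.Icc (-h) h, y * fejer y = 0 := by
    rw [integral_Icc_eq_integral_Ioc, ← intervalIntegral.integral_of_le (by linarith)]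
    have := intervalIntegral.integral_comp_neg (a := -h) (b := h) (fun y => y * fejer y)
    simp only [fejer_neg, neg_neg, neg_mul, intervalIntegral.integral_neg] at this
    linarith
  have hoddint : IntegrableOn (fun y => y * fejer y) (Set.Icc (-h) h) :=
    (continuous_id.mul continuous_fejer).integrableOn_Icc
  have htail : ∫ y in (Set.Icc (-h) h)ᶜ, fejer y ≤ 1 / 4 := by
    refine (setIntegral_fejer_compl_Icc_le hpos).trans_eq ?_
    rw [hh]
    field_simp
    norm_num
  have hgi : Integrable fun y => g y * fejer y :=
    integrable_fejer.bdd_mul (c := η) hg.aestronglyMeasurable (Filter.Eventually.of_forall hη)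
  have hsplit := integral_add_compl (measurableSet_Icc (a := -h) (b := h)) hgi
  have hsplit1 := integral_add_compl (measurableSet_Icc (a := -h) (b := h)) integrable_fejer
  have hin : ∫ y in Set.Icc (-h) h, (A * fejer y + m * (y * fejer y)) ≤
      ∫ y in Set.Icc (-h) h, g y * fejer y := by
    refine setIntegral_mono_on ((integrable_fejer.integrableOn.const_mul _).add
      (hoddint.const_mul _)) hgi.integrableOn measurableSet_Icc fun y hy => ?_
    nlinarith [hlow y hy, fejer_nonneg y]
  have hout : ∫ y in (Set.Icc (-h) h)ᶜ, (-η) * fejer y ≤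
      ∫ y in (Set.Icc (-h) h)ᶜ, g y * fejer y := by
    refine setIntegral_mono_on (integrable_fejer.integrableOn.const_mul _) hgi.integrableOn
      measurableSet_Icc.compl fun y _ => ?_
    exact mul_le_mul_of_nonneg_right (abs_le.1 (hη y)).1 (fejer_nonneg y)
  rw [integral_add (integrable_fejer.integrableOn.const_mul _) (hoddint.const_mul _),
    integral_const_mul, integral_const_mul, hodd] at hin
  rw [integral_const_mul] at hout
  rw [integral_fejer] at hsplit1
  rw [eq_sub_of_add_eq hsplit1] at hin
  nlinarith [mul_le_mul_of_nonneg_left htail (by linarith : 0 ≤ η + A)]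

/-- **Esseen's smoothing inequality**. -/
theorem abs_cdf_sub_le_of_charFun (μ ν : Measure ℝ) [IsProbabilityMeasure μ]
    [IsProbabilityMeasure ν] (hμ : Integrable id μ) (hν : Integrable id ν) {T m : ℝ} (hT : 0 < T)
    (hm : ∀ x y, x ≤ y → ν.real (Set.Iic y) - ν.real (Set.Iic x) ≤ m * (y - x))
    {b : ℝ → ℝ} (hb : IntervalIntegrable b volume 0 1)
    (hle : ∀ u ∈ Set.Ioc (0 : ℝ) 1, ‖charFun μ (u * T) - charFun ν (u * T)‖ ≤ u * b u) (x : ℝ) :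
    |ν.real (Set.Iic x) - μ.real (Set.Iic x)| ≤
      2 * (Real.pi⁻¹ * ∫ u in (0 : ℝ)..1, b u) + 24 * m / (Real.pi * T) := by
  set Δ : ℝ → ℝ := fun x => ν.real (Set.Iic x) - μ.real (Set.Iic x) with hΔ
  set E := Real.pi⁻¹ * ∫ u in (0 : ℝ)..1, b u with hE
  have hpi := Real.pi_pos
  have hmono (ρ : Measure ℝ) [IsProbabilityMeasure ρ] : Monotone fun y => ρ.real (Set.Iic y) :=
    fun y z hyz => measureReal_mono (Set.Iic_subset_Iic.2 hyz)
  have hΔm : Measurable Δ := (hmono ν).measurable.sub (hmono μ).measurable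
  have hE' (t : ℝ) : |∫ y, Δ (t + y / T) * fejer y| ≤ E :=
    abs_integral_cdf_sub_mul_fejer_le μ ν hμ hν hT hb hle t
  have hE0 : 0 ≤ E := (abs_nonneg _).trans (hE' 0)
  have hm0 : 0 ≤ m := by
    have h1 := hm 0 1 zero_le_one
    have h2 := hmono ν (zero_le_one (α := ℝ))
    simp only at h2
    linarith
  have hbdd : BddAbove (Set.range fun x => |Δ x|) := by
    refine ⟨1, ?_⟩
    rintro _ ⟨y, rfl⟩
    have h1 : ν.real (Set.Iic y) ≤ 1 := measureReal_le_one
    have h2 : μ.real (Set.Iic y) ≤ 1 := measureReal_le_one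
    have h3 : 0 ≤ ν.real (Set.Iic y) := measureReal_nonneg
    have h4 : 0 ≤ μ.real (Set.Iic y) := measureReal_nonneg
    simp only [hΔ, abs_le]
    constructor <;> linarith
  set η := ⨆ x, |Δ x| with hηdef
  have hη (y : ℝ) : |Δ y| ≤ η := le_ciSup hbdd y
  have hη0 : 0 ≤ η := (abs_nonneg _).trans (hη 0)
  set H := 16 / Real.pi with hH
  have hHT : 0 ≤ m * (H / T) := by positivity
  have key (θ : ℝ) (g : ℝ → ℝ) (hg : Measurable g) (hgη : ∀ y, |g y| ≤ η) (m' : ℝ)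
      (hlow : ∀ y ∈ Set.Icc (-H) H, (θ - m * (H / T)) + m' * y ≤ g y)
      (hgE : ∫ y, g y * fejer y ≤ E) : θ ≤ 4 / 3 * E + η / 3 + m * (H / T) := by
    by_cases hA : -η ≤ θ - m * (H / T)
    · have := integral_mul_fejer_ge hg hgη hA hlow
      linarith
    · linarith
  have hupper (x : ℝ) : Δ x ≤ 4 / 3 * E + η / 3 + m * (H / T) := by
    refine key (Δ x) (fun y => Δ ((x - H / T) + y / T)) (hΔm.comp (by fun_prop)) (fun y => hη _)
      (m / T) (fun y hy => ?_) ((le_abs_self _).trans (hE' _))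
    have hle : x - H / T + y / T ≤ x := by
      have : y / T ≤ H / T := by gcongr; exact hy.2
      linarith
    have h1 := hm _ _ hle
    have h2 := hmono μ hle
    simp only [hΔ] at h2 ⊢
    have h3 : m * (x - (x - H / T + y / T)) = m * (H / T) - m / T * y := by ring
    linarith
  have hlower (x : ℝ) : -Δ x ≤ 4 / 3 * E + η / 3 + m * (H / T) := by
    refine key (-Δ x) (fun y => -Δ ((x + H / T) + y / T)) (hΔm.comp (by fun_prop)).neg
      (fun y => (abs_neg _).trans_le (hη _))
      (-(m / T)) (fun y hy => ?_) ?_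
    · have hle : x ≤ x + H / T + y / T := by
        have : (-H) / T ≤ y / T := by gcongr; exact hy.1
        rw [neg_div] at this
        linarith
      have h1 := hm _ _ hle
      have h2 := hmono μ hle
      simp only [hΔ] at h2 ⊢
      have h3 : m * ((x + H / T + y / T) - x) = m * (H / T) + m / T * y := by ring
      linarith
    · simp only [neg_mul, integral_neg]
      exact (neg_le_abs _).trans (hE' _)
  have hsup : η ≤ 4 / 3 * E + η / 3 + m * (H / T) :=
    ciSup_le fun x => abs_le.2 ⟨by linarith [hlower x], hupper x⟩
  have hfin : 24 * m / (Real.pi * T) = 3 / 2 * (m * (H / T)) := by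
    rw [hH]
    ring
  rw [hfin]
  linarith [hη x]

open Complex in
lemma norm_exp_mul_I_sub_taylor_two_le (x : ℝ) :
    ‖exp (x * I) - (1 + x * I - x ^ 2 / 2)‖ ≤ |x| ^ 3 / 6 := by
  have hexp (y : ℝ) : HasDerivAt (fun y : ℝ => exp (y * I)) (exp (y * I) * I) y := by
    have h1 : HasDerivAt (fun y : ℝ => (y : ℂ) * I) I y := by
      simpa using (ofRealCLM.hasDerivAt (x := y)).mul_const I
    exact h1.cexp
  have hid (y : ℝ) : HasDerivAt (fun y : ℝ => (y : ℂ)) 1 y := ofRealCLM.hasDerivAt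
  have first (x : ℝ) (hx : 0 ≤ x) : ‖exp (x * I) - (1 + x * I)‖ ≤ x ^ 2 / 2 := by
    refine image_norm_le_of_norm_deriv_right_le_deriv_boundary (a := 0) (b := x)
      (f := fun y : ℝ => exp (y * I) - (1 + y * I)) (f' := fun y => exp (y * I) * I - I)
      (B := fun y => y ^ 2 / 2) (B' := fun y => y) (by fun_prop)
      (fun y _ => ?_) (by simp) (fun y => ?_) (fun y hy => ?_) ⟨hx, le_rfl⟩
    · have := (hexp y).sub (((hid y).mul_const I).const_add 1)
      refine (this.congr_deriv ?_).hasDerivWithinAt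
      simp
    · refine ((hasDerivAt_pow 2 y).div_const 2).congr_deriv ?_
      simp
    · have h := Real.norm_exp_I_mul_ofReal_sub_one_le (x := y)
      rw [Real.norm_of_nonneg hy.1, mul_comm] at h
      rwa [← sub_one_mul, norm_mul, norm_I, mul_one]
  have second (x : ℝ) (hx : 0 ≤ x) : ‖exp (x * I) - (1 + x * I - x ^ 2 / 2)‖ ≤ x ^ 3 / 6 := by
    refine image_norm_le_of_norm_deriv_right_le_deriv_boundary (a := 0) (b := x)
      (f := fun y : ℝ => exp (y * I) - (1 + y * I - y ^ 2 / 2))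
      (f' := fun y => exp (y * I) * I - (I - y))
      (B := fun y => y ^ 3 / 6) (B' := fun y => y ^ 2 / 2) (by fun_prop)
      (fun y _ => ?_) (by simp) (fun y => ?_) (fun y hy => ?_) ⟨hx, le_rfl⟩
    · have := (hexp y).sub ((((hid y).mul_const I).const_add 1).sub
        (((hid y).pow 2).div_const 2))
      refine (this.congr_deriv ?_).hasDerivWithinAt
      simp
    · refine ((hasDerivAt_pow 3 y).div_const 6).congr_deriv ?_
      norm_num
      ring
    · have h := first y hy.1
      have h2 : exp (y * I) * I - (I - y) = (exp (y * I) - (1 + y * I)) * I := by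
        ring_nf
        simp
      rwa [h2, norm_mul, norm_I, mul_one]
  rcases le_total 0 x with hx | hx
  · simpa [abs_of_nonneg hx] using second x hx
  · have h := second (-x) (neg_nonneg.2 hx)
    rw [abs_of_nonpos hx, ← norm_conj]
    convert h using 2
    simp [← exp_conj, Complex.conj_ofNat]

lemma exp_neg_le_quadratic {x : ℝ} (hx : 0 ≤ x) : Real.exp (-x) ≤ 1 - x + x ^ 2 / 2 := by
  have h := Real.quadratic_le_exp_of_nonneg hx
  have hp : 0 < 1 + x + x ^ 2 / 2 := by positivity
  have hprod : 1 ≤ (1 - x + x ^ 2 / 2) * (1 + x + x ^ 2 / 2) := by nlinarith [sq_nonneg (x ^ 2)]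
  rw [Real.exp_neg]
  calc (Real.exp x)⁻¹ ≤ (1 + x + x ^ 2 / 2)⁻¹ := by gcongr
    _ ≤ 1 - x + x ^ 2 / 2 := by
        rw [inv_le_iff_one_le_mul₀ hp]
        exact hprod

lemma abs_exp_neg_half_sq_sub_le {s : ℝ} (hs : 0 ≤ s) :
    |1 - s ^ 2 / 2 - Real.exp (-(s ^ 2 / 2))| ≤ s ^ 3 / 4 := by
  have h1 := Real.add_one_le_exp (-(s ^ 2 / 2))
  have h2 := exp_neg_le_quadratic (x := s ^ 2 / 2) (by positivity)
  have h3 : Real.exp (-(s ^ 2 / 2)) ≤ 1 := Real.exp_le_one_iff.2 (by nlinarith)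
  have h4 : 0 ≤ s ^ 3 := by positivity
  rw [abs_le]
  refine ⟨?_, by linarith⟩
  rcases le_total s 2 with h | h
  · nlinarith [mul_nonneg (sub_nonneg.2 h) h4]
  · nlinarith [mul_nonneg (sub_nonneg.2 h) (sq_nonneg s)]

section CharFun

variable {Z : Type*} [Fintype Z] {P Y : Z → ℝ}

lemma sum_sq_pow_three_halves_le (hP : IsDist P) {s : ℝ} (hs : 0 ≤ s)
    (hv : s ^ 2 = ∑ z, P z * Y z ^ 2) : s ^ 3 ≤ ∑ z, P z * |Y z| ^ 3 := by
  have h : ∑ z, P z * (3 * s * Y z ^ 2) ≤ ∑ z, P z * (2 * |Y z| ^ 3 + s ^ 3) := by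
    refine sum_le_sum fun z _ => mul_le_mul_of_nonneg_left ?_ (hP.1 z)
    rw [← sq_abs (Y z)]
    nlinarith [mul_nonneg (sq_nonneg (|Y z| - s)) (by positivity : 0 ≤ 2 * |Y z| + s)]
  have h1 : ∑ z, P z * (3 * s * Y z ^ 2) = 3 * s * s ^ 2 := by
    rw [hv, mul_sum]
    exact sum_congr rfl fun z _ => by ring
  have h2 : ∑ z, P z * (2 * |Y z| ^ 3 + s ^ 3) = 2 * ∑ z, P z * |Y z| ^ 3 + s ^ 3 := by
    simp_rw [mul_add, sum_add_distrib, ← sum_mul, hP.2, one_mul, mul_sum]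
    congr 1
    exact sum_congr rfl fun z _ => by ring
  rw [h1, h2] at h
  nlinarith

open Complex in
lemma norm_charFun_sub_quadratic_le (hP : IsDist P) (h0 : ∑ z, P z * Y z = 0) :
    ‖∑ z, (P z : ℂ) * exp (Y z * I) - ((1 - (∑ z, P z * Y z ^ 2) / 2 : ℝ) : ℂ)‖ ≤
      (∑ z, P z * |Y z| ^ 3) / 6 := by
  have h : ((1 - (∑ z, P z * Y z ^ 2) / 2 : ℝ) : ℂ) =
      ∑ z, (P z : ℂ) * (1 + Y z * I - Y z ^ 2 / 2) := by
    have h1 : (∑ z, (P z : ℂ)) = 1 := by exact_mod_cast hP.2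
    have h2 : (∑ z, (P z : ℂ) * Y z) = 0 := by exact_mod_cast h0
    simp_rw [mul_sub, mul_add, sum_sub_distrib, sum_add_distrib, ← mul_assoc, ← sum_mul, h2,
      mul_one, h1, mul_div_assoc', ← sum_div]
    push_cast
    ring
  rw [h, ← sum_sub_distrib, sum_div]
  refine (norm_sum_le _ _).trans (sum_le_sum fun z _ => ?_)
  rw [← mul_sub, norm_mul, norm_real, Real.norm_of_nonneg (hP.1 z), mul_div_assoc]
  exact mul_le_mul_of_nonneg_left (norm_exp_mul_I_sub_taylor_two_le _) (hP.1 z)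

open Complex in
lemma norm_charFun_le_exp (hP : IsDist P) (h0 : ∑ z, P z * Y z = 0) :
    ‖∑ z, (P z : ℂ) * exp (Y z * I)‖ ≤
      Real.exp (-(∑ z, P z * Y z ^ 2) / 2 + 3 / 8 * ∑ z, P z * |Y z| ^ 3) := by
  have hq := norm_charFun_sub_quadratic_le hP h0
  have hv0 : 0 ≤ ∑ z, P z * Y z ^ 2 := sum_nonneg fun z _ => mul_nonneg (hP.1 z) (sq_nonneg _)
  have hr0 : 0 ≤ ∑ z, P z * |Y z| ^ 3 := sum_nonneg fun z _ => mul_nonneg (hP.1 z) (by positivity)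
  have hl := sum_sq_pow_three_halves_le (Y := Y) hP (Real.sqrt_nonneg _) (Real.sq_sqrt hv0)
  have hs := Real.sq_sqrt hv0
  have hs0 := Real.sqrt_nonneg (∑ z, P z * Y z ^ 2)
  set s := √(∑ z, P z * Y z ^ 2)
  set r := ∑ z, P z * |Y z| ^ 3
  rw [← hs] at hq ⊢
  rcases le_total (s ^ 2) 2 with h | h
  · have h1 : ‖((1 - s ^ 2 / 2 : ℝ) : ℂ)‖ = 1 - s ^ 2 / 2 := by
      rw [norm_real, Real.norm_of_nonneg (by linarith)]
    have h2 := norm_le_norm_add_norm_sub' (∑ z, (P z : ℂ) * exp (Y z * I))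
      ((1 - s ^ 2 / 2 : ℝ) : ℂ)
    rw [h1] at h2
    have h3 := Real.add_one_le_exp (-s ^ 2 / 2 + 3 / 8 * r)
    linarith
  · have h1 : ‖∑ z, (P z : ℂ) * exp (Y z * I)‖ ≤ 1 := by
      refine (norm_sum_le _ _).trans_eq ?_
      rw [← hP.2]
      refine sum_congr rfl fun z _ => ?_
      rw [norm_mul, norm_exp_ofReal_mul_I, norm_real, Real.norm_of_nonneg (hP.1 z), mul_one]
    refine h1.trans (Real.one_le_exp ?_)
    have h2 : 4 / 3 ≤ s := by nlinarith
    nlinarith [mul_nonneg (sub_nonneg.2 h2) (sq_nonneg s)]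

open Complex in
lemma norm_charFun_sub_gaussian_le (hP : IsDist P) (h0 : ∑ z, P z * Y z = 0) :
    ‖∑ z, (P z : ℂ) * exp (Y z * I) - ((Real.exp (-(∑ z, P z * Y z ^ 2) / 2) : ℝ) : ℂ)‖ ≤
      13 / 24 * (∑ z, P z * |Y z| ^ 3) *
        Real.exp (-(∑ z, P z * Y z ^ 2) / 2 + 3 / 8 * ∑ z, P z * |Y z| ^ 3) := by
  have hq := norm_charFun_sub_quadratic_le hP h0
  have hv0 : 0 ≤ ∑ z, P z * Y z ^ 2 := sum_nonneg fun z _ => mul_nonneg (hP.1 z) (sq_nonneg _)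
  have hr0 : 0 ≤ ∑ z, P z * |Y z| ^ 3 := sum_nonneg fun z _ => mul_nonneg (hP.1 z) (by positivity)
  have hl := sum_sq_pow_three_halves_le (Y := Y) hP (Real.sqrt_nonneg _) (Real.sq_sqrt hv0)
  have hs := Real.sq_sqrt hv0
  have hs0 := Real.sqrt_nonneg (∑ z, P z * Y z ^ 2)
  set s := √(∑ z, P z * Y z ^ 2)
  set r := ∑ z, P z * |Y z| ^ 3
  rw [← hs] at hq ⊢
  have h1 : ‖((1 - s ^ 2 / 2 : ℝ) : ℂ) - ((Real.exp (-s ^ 2 / 2) : ℝ) : ℂ)‖ ≤ s ^ 3 / 4 := by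
    rw [← ofReal_sub, norm_real, neg_div]
    exact abs_exp_neg_half_sq_sub_le hs0
  have h2 := norm_sub_le_norm_sub_add_norm_sub (∑ z, (P z : ℂ) * exp (Y z * I))
    ((1 - s ^ 2 / 2 : ℝ) : ℂ) ((Real.exp (-s ^ 2 / 2) : ℝ) : ℂ)
  have h3 : -(1 / 4) ≤ -s ^ 2 / 2 + 3 / 8 * r := by
    nlinarith [mul_nonneg (sq_nonneg (s - 8 / 9)) (by positivity : 0 ≤ 3 / 8 * s + 1 / 6)]
  have h4 : 10 / 13 ≤ Real.exp (-s ^ 2 / 2 + 3 / 8 * r) := by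
    refine le_trans ?_ (Real.exp_le_exp.2 h3)
    rw [Real.exp_neg, ← inv_div]
    have he : Real.exp (1 / 4) ≤ 13 / 10 := by
      refine le_of_pow_le_pow_left₀ (n := 4) (by norm_num) (by norm_num) ?_
      rw [← Real.exp_nat_mul]
      norm_num
      linarith [Real.exp_one_lt_d9]
    gcongr
  nlinarith [mul_le_mul_of_nonneg_left h4 hr0]

end CharFun

lemma norm_prod_sub_prod_le {ι : Type*} (t : Finset ι) (a b : ι → ℂ) (M c : ι → ℝ)
    (ha : ∀ i ∈ t, ‖a i‖ ≤ M i) (hb : ∀ i ∈ t, ‖b i‖ ≤ M i)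
    (hab : ∀ i ∈ t, ‖a i - b i‖ ≤ c i * M i) :
    ‖∏ i ∈ t, a i - ∏ i ∈ t, b i‖ ≤ (∑ i ∈ t, c i) * ∏ i ∈ t, M i := by
  classical
  induction t using Finset.induction_on with
  | empty => simp
  | insert i t hi ih =>
    simp only [mem_insert, forall_eq_or_imp] at ha hb hab
    have ih := ih ha.2 hb.2 hab.2
    rw [prod_insert hi, prod_insert hi, prod_insert hi, sum_insert hi]
    have hB : ‖∏ j ∈ t, b j‖ ≤ ∏ j ∈ t, M j := by
      rw [norm_prod]
      exact prod_le_prod (fun _ _ => norm_nonneg _) hb.2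
    have hM : 0 ≤ M i := (norm_nonneg _).trans ha.1
    calc ‖a i * ∏ j ∈ t, a j - b i * ∏ j ∈ t, b j‖
        = ‖a i * (∏ j ∈ t, a j - ∏ j ∈ t, b j) + (a i - b i) * ∏ j ∈ t, b j‖ := by ring_nf
      _ ≤ ‖a i‖ * ‖∏ j ∈ t, a j - ∏ j ∈ t, b j‖ + ‖a i - b i‖ * ‖∏ j ∈ t, b j‖ := by
          refine (norm_add_le _ _).trans_eq ?_
          rw [norm_mul, norm_mul]
      _ ≤ M i * ((∑ j ∈ t, c j) * ∏ j ∈ t, M j) + (c i * M i) * ∏ j ∈ t, M j := by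
          gcongr
          · exact ha.1
          · exact (norm_nonneg _).trans hab.1
          · exact hab.1
      _ = _ := by ring

lemma integral_sq_mul_exp_neg_le {T : ℝ} (hT : 0 ≤ T) :
    ∫ x in (0 : ℝ)..T, x ^ 2 * Real.exp (-x ^ 2 / 6) ≤ 3 / 2 * √(6 * Real.pi) := by
  have hd : ∀ x ∈ Set.uIcc 0 T, HasDerivAt (fun x : ℝ => -3 * x * Real.exp (-x ^ 2 / 6))
      (x ^ 2 * Real.exp (-x ^ 2 / 6) - 3 * Real.exp (-x ^ 2 / 6)) x := by
    intro x _
    have h1 : HasDerivAt (fun x : ℝ => -x ^ 2 / 6) (-(2 * x) / 6) x := by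
      refine ((hasDerivAt_pow 2 x).neg.div_const 6).congr_deriv ?_
      simp
    have h2 : HasDerivAt (fun x : ℝ => -3 * x) (-3) x := by
      simpa using (hasDerivAt_id x).const_mul (-3)
    refine (h2.mul h1.exp).congr_deriv ?_
    ring
  have hparts := intervalIntegral.integral_eq_sub_of_hasDerivAt hd
    (Continuous.intervalIntegrable (by fun_prop) _ _)
  rw [intervalIntegral.integral_sub (Continuous.intervalIntegrable (by fun_prop) _ _)
    (Continuous.intervalIntegrable (by fun_prop) _ _), intervalIntegral.integral_const_mul]
    at hparts
  have hgauss : ∫ x in (0 : ℝ)..T, Real.exp (-x ^ 2 / 6) ≤ √(6 * Real.pi) / 2 := by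
    have h := integral_gaussian_Ioi (1 / 6)
    have hcongr : ∀ x : ℝ, Real.exp (-x ^ 2 / 6) = Real.exp (-(1 / 6) * x ^ 2) := fun x => by
      ring_nf
    simp_rw [hcongr]
    rw [show 6 * Real.pi = Real.pi / (1 / 6) by ring, ← h,
      intervalIntegral.integral_of_le hT]
    refine setIntegral_mono_set (integrable_exp_neg_mul_sq (by norm_num)).integrableOn
      (Filter.Eventually.of_forall fun x => (Real.exp_pos _).le) ?_
    exact Set.Ioc_subset_Ioi_self.eventuallyLE
  have hpos : 0 ≤ T * Real.exp (-T ^ 2 / 6) := by positivity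
  simp only [mul_zero, zero_mul, sub_zero] at hparts
  linarith

open ProbabilityTheory in
lemma stdPhi_eq_gaussianReal (a : ℝ) : stdPhi a = (gaussianReal 0 1).real (Set.Iic a) := by
  rw [measureReal_def, gaussianReal_apply_eq_integral _ one_ne_zero, ENNReal.toReal_ofReal
    (integral_nonneg (gaussianPDFReal_nonneg _ _)), stdPhi]
  congr 1 with x
  simp [gaussianPDFReal]
  ring

open ProbabilityTheory in
lemma gaussianReal_Iic_sub_le (x y : ℝ) (hxy : x ≤ y) :
    (gaussianReal 0 1).real (Set.Iic y) - (gaussianReal 0 1).real (Set.Iic x) ≤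
      (√(2 * Real.pi))⁻¹ * (y - x) := by
  have hI (a : ℝ) : (gaussianReal 0 1).real (Set.Iic a) =
      ∫ x in Set.Iic a, gaussianPDFReal 0 1 x := by
    rw [measureReal_def, gaussianReal_apply_eq_integral _ one_ne_zero, ENNReal.toReal_ofReal
      (integral_nonneg (gaussianPDFReal_nonneg _ _))]
  have hint := integrable_gaussianPDFReal 0 1
  rw [hI, hI, intervalIntegral.integral_Iic_sub_Iic hint.integrableOn hint.integrableOn]
  calc ∫ t in x..y, gaussianPDFReal 0 1 t ≤ ∫ t in x..y, (√(2 * Real.pi))⁻¹ := by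
        refine intervalIntegral.integral_mono_on hxy hint.intervalIntegrable (by simp)
          fun t _ => ?_
        simp only [gaussianPDFReal, NNReal.coe_one, mul_one, sub_zero]
        refine mul_le_of_le_one_right (by positivity) (Real.exp_le_one_iff.2 ?_)
        nlinarith [sq_nonneg t]
    _ = _ := by rw [intervalIntegral.integral_const, smul_eq_mul, mul_comm]

/-- The law of the random variable `X` under the finitely supported weights `w`. -/
noncomputable def finiteLaw {Ω : Type*} [Fintype Ω] (w X : Ω → ℝ) : Measure ℝ :=
  ∑ ω, ENNReal.ofReal (w ω) • Measure.dirac (X ω)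

section FiniteLaw

variable {Ω : Type*} [Fintype Ω] {w X : Ω → ℝ}

lemma isProbabilityMeasure_finiteLaw (hw : IsDist w) : IsProbabilityMeasure (finiteLaw w X) := by
  constructor
  simp [finiteLaw, ← ENNReal.ofReal_sum_of_nonneg fun i _ => hw.1 i, hw.2]

lemma integrable_finiteLaw {E : Type*} [NormedAddCommGroup E] (f : ℝ → E) :
    Integrable f (finiteLaw w X) := by
  rw [finiteLaw, integrable_finsetSum_measure]
  exact fun i _ => (integrable_dirac (by simp)).smul_measure ENNReal.ofReal_ne_top

lemma integral_finiteLaw (hw : IsDist w) {E : Type*} [NormedAddCommGroup E] [NormedSpace ℝ E]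
    [CompleteSpace E] (f : ℝ → E) : ∫ x, f x ∂(finiteLaw w X) = ∑ ω, w ω • f (X ω) := by
  rw [finiteLaw, integral_finsetSum_measure
    fun i _ => (integrable_dirac (by simp)).smul_measure ENNReal.ofReal_ne_top]
  refine sum_congr rfl fun i _ => ?_
  rw [integral_smul_measure, integral_dirac, ENNReal.toReal_ofReal (hw.1 i)]

lemma finiteLaw_real_Iic (hw : IsDist w) (a : ℝ) :
    (finiteLaw w X).real (Set.Iic a) = ∑ ω, if X ω ≤ a then w ω else 0 := by
  have : IsProbabilityMeasure (finiteLaw w X) := isProbabilityMeasure_finiteLaw hw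
  rw [← integral_indicator_one measurableSet_Iic, integral_finiteLaw hw]
  simp [Set.indicator_apply]

end FiniteLaw

lemma isDist_prod {ι Z : Type*} [Fintype ι] [DecidableEq ι] [Fintype Z] {P : ι → Z → ℝ}
    (hP : ∀ k, IsDist (P k)) : IsDist fun zs : ι → Z => ∏ k, P k (zs k) := by
  refine ⟨fun zs => prod_nonneg fun k _ => (hP k).1 _, ?_⟩
  rw [← Fintype.piFinset_univ, ← prod_univ_sum]
  simp [(hP _).2]

lemma charFun_finiteLaw_prod {ι Z : Type*} [Fintype ι] [DecidableEq ι] [Fintype Z]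
    {P : ι → Z → ℝ} (hP : ∀ k, IsDist (P k)) (X : ι → Z → ℝ) (t : ℝ) :
    charFun (finiteLaw (fun zs : ι → Z => ∏ k, P k (zs k)) fun zs => ∑ k, X k (zs k)) t =
      ∏ k, ∑ z, (P k z : ℂ) * Complex.exp (↑(t * X k z) * Complex.I) := by
  rw [charFun_apply_real, integral_finiteLaw (isDist_prod hP), prod_univ_sum,
    Fintype.piFinset_univ]
  refine sum_congr rfl fun zs _ => ?_
  rw [prod_mul_distrib, ← Complex.exp_sum, Complex.real_smul]
  push_cast
  rw [mul_sum, sum_mul]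

open ProbabilityTheory in
/-- The characteristic function of a normalised sum is close to the Gaussian one. -/
lemma norm_charFun_finiteLaw_prod_sub_le {ι Z : Type*} [Fintype ι] [DecidableEq ι] [Fintype Z]
    {P : ι → Z → ℝ} (hP : ∀ k, IsDist (P k)) {X : ι → Z → ℝ} (h0 : ∀ k, ∑ z, P k z * X k z = 0)
    (h1 : ∑ k, ∑ z, P k z * X k z ^ 2 = 1) {L : ℝ} (hL : L = ∑ k, ∑ z, P k z * |X k z| ^ 3)
    {t : ℝ} (ht : 0 ≤ t) (htL : t * L ≤ 8 / 9) :
    ‖charFun (finiteLaw (fun zs : ι → Z => ∏ k, P k (zs k)) fun zs => ∑ k, X k (zs k)) t -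
      charFun (gaussianReal 0 1) t‖ ≤ 13 / 24 * L * t ^ 3 * Real.exp (-t ^ 2 / 6) := by
  have hv (k : ι) : ∑ z, P k z * (t * X k z) ^ 2 = t ^ 2 * ∑ z, P k z * X k z ^ 2 := by
    rw [mul_sum]
    exact sum_congr rfl fun z _ => by ring
  have hr (k : ι) : ∑ z, P k z * |t * X k z| ^ 3 = t ^ 3 * ∑ z, P k z * |X k z| ^ 3 := by
    rw [mul_sum]
    refine sum_congr rfl fun z _ => ?_
    rw [abs_mul, abs_of_nonneg ht]
    ring
  have h0' (k : ι) : ∑ z, P k z * (t * X k z) = 0 := by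
    have : ∑ z, P k z * (t * X k z) = t * ∑ z, P k z * X k z := by
      rw [mul_sum]
      exact sum_congr rfl fun z _ => by ring
    rw [this, h0, mul_zero]
  have hr0 (k : ι) : 0 ≤ ∑ z, P k z * |t * X k z| ^ 3 :=
    sum_nonneg fun z _ => mul_nonneg ((hP k).1 z) (by positivity)
  have hvsum : ∑ k, ∑ z, P k z * (t * X k z) ^ 2 = t ^ 2 := by
    simp_rw [hv, ← mul_sum, h1, mul_one]
  have hrsum : ∑ k, ∑ z, P k z * |t * X k z| ^ 3 = L * t ^ 3 := by
    simp_rw [hr, ← mul_sum, ← hL, mul_comm]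
  have hgauss : charFun (gaussianReal 0 1) t =
      ∏ k, ((Real.exp (-(∑ z, P k z * (t * X k z) ^ 2) / 2) : ℝ) : ℂ) := by
    rw [charFun_gaussianReal, ← Complex.ofReal_prod, ← Real.exp_sum, ← sum_div,
      sum_neg_distrib, hvsum]
    push_cast
    congr 1
    simp
    ring
  rw [charFun_finiteLaw_prod hP, hgauss]
  refine (norm_prod_sub_prod_le univ _ _
    (fun k => Real.exp (-(∑ z, P k z * (t * X k z) ^ 2) / 2 +
      3 / 8 * ∑ z, P k z * |t * X k z| ^ 3))
    (fun k => 13 / 24 * ∑ z, P k z * |t * X k z| ^ 3)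
    (fun k _ => norm_charFun_le_exp (hP k) (h0' k)) (fun k _ => ?_)
    (fun k _ => norm_charFun_sub_gaussian_le (hP k) (h0' k))).trans ?_
  · rw [Complex.norm_real, Real.norm_of_nonneg (Real.exp_pos _).le]
    exact Real.exp_le_exp.2 (by linarith [hr0 k])
  · rw [← Real.exp_sum, sum_add_distrib, ← mul_sum, ← mul_sum, ← sum_div, sum_neg_distrib,
      hvsum, hrsum]
    have hL0 : 0 ≤ L := by
      rw [hL]
      exact sum_nonneg fun k _ => sum_nonneg fun z _ => mul_nonneg ((hP k).1 z) (by positivity)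
    rw [← mul_assoc]
    gcongr
    nlinarith [mul_le_mul_of_nonneg_left htL (sq_nonneg t)]

/-- **Berry–Esseen inequality** for sums of independent finitely supported random variables,
normalised to have mean zero and total variance one. -/
theorem berry_esseen_of_finite {ι Z : Type*} [Fintype ι] [DecidableEq ι] [Fintype Z]
    {P : ι → Z → ℝ} (hP : ∀ k, IsDist (P k)) {X : ι → Z → ℝ} (h0 : ∀ k, ∑ z, P k z * X k z = 0)
    (h1 : ∑ k, ∑ z, P k z * X k z ^ 2 = 1) (a : ℝ) :
    |stdPhi a - ∑ zs : ι → Z, if ∑ k, X k (zs k) ≤ a then ∏ k, P k (zs k) else 0| ≤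
      6 * ∑ k, ∑ z, P k z * |X k z| ^ 3 := by
  set L := ∑ k, ∑ z, P k z * |X k z| ^ 3 with hL
  have hnn (k : ι) (z : Z) : 0 ≤ P k z * |X k z| ^ 3 := mul_nonneg ((hP k).1 z) (by positivity)
  have hLpos : 0 < L := by
    by_contra! hle
    have hz : ∀ k z, P k z * |X k z| ^ 3 = 0 := by
      have hL0 : L = 0 := le_antisymm hle (sum_nonneg fun k _ => sum_nonneg fun z _ => hnn k z)
      rw [hL, sum_eq_zero_iff_of_nonneg fun k _ => sum_nonneg fun z _ => hnn k z] at hL0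
      exact fun k z =>
        (sum_eq_zero_iff_of_nonneg fun z _ => hnn k z).1 (hL0 k (mem_univ k)) z (mem_univ z)
    have : ∑ k, ∑ z, P k z * X k z ^ 2 = 0 := by
      refine sum_eq_zero fun k _ => sum_eq_zero fun z _ => ?_
      have := hz k z
      simp only [mul_eq_zero, pow_eq_zero_iff, abs_eq_zero, ne_eq, OfNat.ofNat_ne_zero,
        not_false_eq_true] at this ⊢
      exact this
    linarith
  set T := 8 / (9 * L) with hT
  have hTpos : 0 < T := by positivity
  have hw := isDist_prod hP
  have : IsProbabilityMeasure (finiteLaw (fun zs : ι → Z => ∏ k, P k (zs k))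
    fun zs => ∑ k, X k (zs k)) := isProbabilityMeasure_finiteLaw hw
  set b : ℝ → ℝ := fun u =>
    13 / 24 * L * (T * ((u * T) ^ 2 * Real.exp (-(u * T) ^ 2 / 6))) with hb
  have hsmooth := abs_cdf_sub_le_of_charFun
    (finiteLaw (fun zs : ι → Z => ∏ k, P k (zs k)) fun zs => ∑ k, X k (zs k))
    (ProbabilityTheory.gaussianReal 0 1) (integrable_finiteLaw _)
    (memLp_one_iff_integrable.1 (ProbabilityTheory.memLp_id_gaussianReal 1)) hTpos
    gaussianReal_Iic_sub_le (b := b) (Continuous.intervalIntegrable (by fun_prop) _ _)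
    (fun u hu => by
      have htL : u * T * L ≤ 8 / 9 := by
        have : T * L = 8 / 9 := by
          rw [hT]
          field_simp
        rw [mul_assoc, this]
        linarith [hu.2]
      refine (norm_charFun_finiteLaw_prod_sub_le hP h0 h1 hL (mul_nonneg hu.1.le hTpos.le)
        htL).trans_eq ?_
      rw [hb]
      ring) a
  rw [finiteLaw_real_Iic hw, ← stdPhi_eq_gaussianReal] at hsmooth
  refine hsmooth.trans ?_
  have hbint : ∫ u in (0 : ℝ)..1, b u ≤ 13 / 24 * L * (3 / 2 * √(6 * Real.pi)) := by
    rw [hb, intervalIntegral.integral_const_mul, intervalIntegral.integral_const_mul,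
      intervalIntegral.mul_integral_comp_mul_right (f := fun x => x ^ 2 * Real.exp (-x ^ 2 / 6)),
      zero_mul, one_mul]
    gcongr
    exact integral_sq_mul_exp_neg_le hTpos.le
  have hpi1 := Real.pi_gt_d2
  have hpi2 := Real.pi_lt_d2
  have hs1 : √(6 * Real.pi) ≤ 4.4 := Real.sqrt_le_iff.2 ⟨by norm_num, by linarith⟩
  have hs2 : 2.5 ≤ √(2 * Real.pi) := Real.le_sqrt_of_sq_le (by linarith)
  have hfirst : 2 * (Real.pi⁻¹ * ∫ u in (0 : ℝ)..1, b u) ≤ 2.4 * L := by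
    calc 2 * (Real.pi⁻¹ * ∫ u in (0 : ℝ)..1, b u)
        ≤ 2 * ((3.14)⁻¹ * (13 / 24 * L * (3 / 2 * 4.4))) := by
          have h2 : ∫ u in (0 : ℝ)..1, b u ≤ 13 / 24 * L * (3 / 2 * 4.4) :=
            hbint.trans (by gcongr)
          have h3 : 0 ≤ ∫ u in (0 : ℝ)..1, b u :=
            intervalIntegral.integral_nonneg zero_le_one fun u _ => by positivity
          gcongr
      _ ≤ 2.4 * L := by linarith
  have hsecond : 24 * (√(2 * Real.pi))⁻¹ / (Real.pi * T) ≤ 3.6 * L := by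
    calc 24 * (√(2 * Real.pi))⁻¹ / (Real.pi * T) ≤ 24 * (2.5)⁻¹ / (3.14 * T) := by gcongr
      _ ≤ 3.6 * L := by
        rw [hT]
        field_simp
        norm_num
  linarith

lemma ite_prod_log_div_le_eq {ι Z : Type*} [Fintype ι] {P : ι → Z → ℝ} {Q : Z → ℝ}
    (hP : ∀ k z, 0 ≤ P k z) (hdom : ∀ k z, 0 < P k z → 0 < Q z) (R : ℝ) (zs : ι → Z) :
    (if (∏ k, P k (zs k) = 0) ∨ (0 < ∏ k, Q (zs k) ∧
        Real.log ((∏ k, P k (zs k)) / ∏ k, Q (zs k)) ≤ R) then ∏ k, P k (zs k) else 0) =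
      if ∑ k, Real.log (P k (zs k) / Q (zs k)) ≤ R then ∏ k, P k (zs k) else 0 := by
  by_cases h0 : ∏ k, P k (zs k) = 0
  · simp [h0]
  · have hpos (k : ι) : 0 < P k (zs k) :=
      (hP k _).lt_of_ne fun h => h0 (prod_eq_zero (mem_univ k) h.symm)
    have hQ (k : ι) : 0 < Q (zs k) := hdom k _ (hpos k)
    have hlog : Real.log ((∏ k, P k (zs k)) / ∏ k, Q (zs k)) =
        ∑ k, Real.log (P k (zs k) / Q (zs k)) := by
      rw [← prod_div_distrib, Real.log_prod fun k _ => (div_pos (hpos k) (hQ k)).ne']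
    simp only [h0, false_or, prod_pos fun k _ => hQ k, true_and, hlog]

lemma sum_dist_mul_sub_div {Z : Type*} [Fintype Z] {P : Z → ℝ} (hP : IsDist P) (Y : Z → ℝ)
    (s : ℝ) : ∑ z, P z * ((Y z - ∑ z, P z * Y z) / s) = 0 := by
  simp_rw [mul_div_assoc', mul_sub, ← sum_div, sum_sub_distrib, ← sum_mul, hP.2]
  simp

/-- Berry–Esseen estimate for the log-likelihood ratio of a product distribution. -/
lemma stdPhi_le_of_sum_log_le {ι Z : Type*} [Fintype ι] [DecidableEq ι] [Fintype Z]
    {P : ι → Z → ℝ} {Q : Z → ℝ} (hP : ∀ k, IsDist (P k)) (hV : 0 < ∑ k, divVar (P k) Q) (R : ℝ) :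
    stdPhi ((R - ∑ k, relEnt (P k) Q) / √(∑ k, divVar (P k) Q)) ≤
      (∑ zs : ι → Z, if ∑ k, Real.log (P k (zs k) / Q (zs k)) ≤ R then ∏ k, P k (zs k) else 0) +
        6 * ((∑ k, divThird (P k) Q) / √(∑ k, divVar (P k) Q) ^ 3) := by
  set s := √(∑ k, divVar (P k) Q) with hs
  have hspos : 0 < s := Real.sqrt_pos.2 hV
  have hs2 : s ^ 2 = ∑ k, divVar (P k) Q := Real.sq_sqrt hV.le
  have h1 : ∑ k, ∑ z, P k z * ((Real.log (P k z / Q z) - relEnt (P k) Q) / s) ^ 2 = 1 := by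
    simp_rw [div_pow, mul_div_assoc', ← sum_div]
    rw [hs2]
    exact div_self hV.ne'
  have h3 : ∑ k, ∑ z, P k z * |(Real.log (P k z / Q z) - relEnt (P k) Q) / s| ^ 3 =
      (∑ k, divThird (P k) Q) / s ^ 3 := by
    simp_rw [abs_div, abs_of_pos hspos, div_pow, mul_div_assoc', ← sum_div]
    rfl
  have hbe := berry_esseen_of_finite hP
    (fun k => sum_dist_mul_sub_div (hP k) (fun z => Real.log (P k z / Q z)) s) h1
    ((R - ∑ k, relEnt (P k) Q) / s)
  have hiff (zs : ι → Z) : (∑ k, (Real.log (P k (zs k) / Q (zs k)) - relEnt (P k) Q) / s ≤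
      (R - ∑ k, relEnt (P k) Q) / s) = (∑ k, Real.log (P k (zs k) / Q (zs k)) ≤ R) := by
    rw [← sum_div, div_le_div_iff_of_pos_right hspos, sum_sub_distrib, sub_le_sub_iff_right]
  change |_ - ∑ zs : ι → Z, if ∑ k, (Real.log (P k (zs k) / Q (zs k)) - relEnt (P k) Q) / s ≤
    (R - ∑ k, relEnt (P k) Q) / s then ∏ k, P k (zs k) else 0| ≤ 6 * ∑ k, ∑ z,
      P k z * |(Real.log (P k z / Q z) - relEnt (P k) Q) / s| ^ 3 at hbe
  simp only [hiff, h3] at hbe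
  linarith [(abs_le.1 hbe).2]

/-- Berry-Esseen-type bound on the information spectrum divergence of a
product of distributions `P_{i_1} × ⋯ × P_{i_n}` against `Q^{×n}`: if `V_n > 0` then
`D_s^ε ≤ n D_n + √(n V_n) Φ⁻¹(ε + 6 T_n / √(n V_n³))`. -/
theorem Ds_product_berry_esseen
    {I Z : Type*} [Fintype I] [Fintype Z]
    (Q : Z → ℝ) (hQ : IsDist Q) (Pd : I → Z → ℝ) (hPd : ∀ i, IsDist (Pd i))
    (hdom : ∀ i z, 0 < Pd i z → 0 < Q z)
    (n : ℕ) (hn : 1 ≤ n) (idx : Fin n → I)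
    (hV : 0 < (1 / (n : ℝ)) * ∑ k : Fin n, divVar (Pd (idx k)) Q)
    (ε : ℝ) (hε : ε ∈ Set.Ioo (0 : ℝ) 1) :
    Ds ε (fun zs : Fin n → Z => ∏ k, Pd (idx k) (zs k))
        (fun zs : Fin n → Z => ∏ k, Q (zs k)) ≤
      (((n : ℝ) * ((1 / (n : ℝ)) * ∑ k : Fin n, relEnt (Pd (idx k)) Q) : ℝ) : EReal)
        + ((Real.sqrt ((n : ℝ) * ((1 / (n : ℝ)) * ∑ k : Fin n, divVar (Pd (idx k)) Q)) : ℝ) : EReal)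
          * PhiInvE (ε + 6 * ((1 / (n : ℝ)) * ∑ k : Fin n, divThird (Pd (idx k)) Q)
              / Real.sqrt ((n : ℝ) * ((1 / (n : ℝ)) * ∑ k : Fin n, divVar (Pd (idx k)) Q) ^ 3)) := by
  have hn0 : (0 : ℝ) < n := by exact_mod_cast hn
  have hcancel (x : ℝ) : (n : ℝ) * (1 / (n : ℝ) * x) = x := by field_simp
  have hVpos : 0 < ∑ k : Fin n, divVar (Pd (idx k)) Q :=
    pos_of_mul_pos_right hV (by positivity)
  have hT : 6 * (1 / (n : ℝ) * ∑ k : Fin n, divThird (Pd (idx k)) Q) /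
      √((n : ℝ) * (1 / (n : ℝ) * ∑ k : Fin n, divVar (Pd (idx k)) Q) ^ 3) =
      6 * ((∑ k : Fin n, divThird (Pd (idx k)) Q) /
        √(∑ k : Fin n, divVar (Pd (idx k)) Q) ^ 3) := by
    have hs2 := Real.sq_sqrt hVpos.le
    have hspos := Real.sqrt_pos.2 hVpos
    set s := √(∑ k : Fin n, divVar (Pd (idx k)) Q)
    have hsq : (n : ℝ) * (1 / (n : ℝ) * ∑ k : Fin n, divVar (Pd (idx k)) Q) ^ 3 =
        (s ^ 3 / n) ^ 2 := by
      rw [← hs2]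
      field_simp
    rw [hsq, Real.sqrt_sq (by positivity)]
    field_simp
  rw [hcancel, hcancel, hT]
  refine sSup_le ?_
  rintro _ ⟨R, hR, rfl⟩
  simp only [Set.mem_ofPred_eq] at hR
  rw [sum_congr rfl fun zs _ => ite_prod_log_div_le_eq (P := fun k => Pd (idx k))
    (fun k => (hPd _).1) (fun k => hdom _) R zs] at hR
  have hPhi := stdPhi_le_of_sum_log_le (P := fun k => Pd (idx k)) (fun k => hPd _) hVpos R
  have hspos := Real.sqrt_pos.2 hVpos
  set s := √(∑ k : Fin n, divVar (Pd (idx k)) Q)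
  set D := ∑ k : Fin n, relEnt (Pd (idx k)) Q
  set e := ε + 6 * ((∑ k : Fin n, divThird (Pd (idx k)) Q) / s ^ 3) with he
  have ha : (((R - D) / s : ℝ) : EReal) ≤ PhiInvE e :=
    le_sSup ⟨(R - D) / s, by simp only [Set.mem_ofPred_eq]; linarith, rfl⟩
  have hReq : (R : EReal) = (D : EReal) + (s : EReal) * (((R - D) / s : ℝ) : EReal) := by
    rw [← EReal.coe_mul, ← EReal.coe_add, mul_div_cancel₀ _ hspos.ne', add_sub_cancel]
  change (R : EReal) ≤ _
  rw [hReq]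
  gcongr
end

section
/- Let W be a channel from a finite set X to a finite set Y, let M ≥ 1, let (e, d) be a code with M messages whose average error probability for W is at most ε ∈ (0,1), and let P be the input distribution induced by a uniform message, i.e. P(x) := (1/M)·#{m | e(m) = x}. Then for every probability distribution Q on Y, D_h^ε(P × W ‖ P × Q) ≥ log M + log(1−ε), where P × W denotes the joint distribution (x,y) ↦ P(x)·W(y|x) and P × Q denotes (x,y) ↦ P(x)·Q(y). -/
open Finset MeasureTheory

/-- Average error probability of the code `(e, d)` with `M` messages for channel `V`. -/
noncomputable def avgErr {A B : Type*} [Fintype B] {M : ℕ} (V : A → B → ℝ)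
    (e : Fin M → A) (d : B → Fin M) : ℝ :=
  1 - (1 / (M : ℝ)) * ∑ m : Fin M, ∑ b ∈ Finset.univ.filter (fun b => d b = m), V (e m) b

/-- `M*(V,ε)`: the largest number of messages of a code with average error probability `≤ ε`. -/
noncomputable def Mstar {A B : Type*} [Fintype B] (V : A → B → ℝ) (ε : ℝ) : ℕ :=
  sSup {M : ℕ | ∃ e : Fin M → A, ∃ d : B → Fin M, avgErr V e d ≤ ε}

/-- `ε`-hypothesis testing divergence `D_h^ε(P‖Q)`, as an extended real. -/
noncomputable def Dh {Z : Type*} [Fintype Z] (ε : ℝ) (P Q : Z → ℝ) : EReal :=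
  sSup ((fun R : ℝ => (R : EReal)) ''
    {R : ℝ | ∃ ξ : Z → ℝ, (∀ z, 0 ≤ ξ z ∧ ξ z ≤ 1) ∧
      (∑ z, Q z * ξ z ≤ (1 - ε) * Real.exp (-R)) ∧ (1 - ε ≤ ∑ z, P z * ξ z)})

/-- The randomized test that, on `(x, y)`, guesses a uniform message among those encoded as `x` and
accepts if it is the decoded message `d y`. -/
noncomputable def codeTest {X Y : Type*} [DecidableEq X] {M : ℕ} (e : Fin M → X) (d : Y → Fin M)
    (p : X × Y) : ℝ :=
  if e (d p.2) = p.1 then ((Finset.univ.filter (fun m : Fin M => e m = p.1)).card : ℝ)⁻¹ else 0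

lemma codeTest_mem_Icc {X Y : Type*} [DecidableEq X] {M : ℕ} (e : Fin M → X) (d : Y → Fin M)
    (p : X × Y) : 0 ≤ codeTest e d p ∧ codeTest e d p ≤ 1 := by
  unfold codeTest
  split_ifs
  · exact ⟨by positivity, Nat.cast_inv_le_one _⟩
  · simp

/-- Under the input distribution induced by a uniform message, the acceptance weight of `codeTest`
is the average over messages: only the input `e (d y)` contributes at output `y`. -/
lemma sum_mul_codeTest {X Y : Type*} [Fintype X] [Fintype Y] [DecidableEq X] {M : ℕ}
    (e : Fin M → X) (d : Y → Fin M) (P : X → ℝ)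
    (hP : ∀ x, P x = (1 / (M : ℝ)) * ((Finset.univ.filter (fun m : Fin M => e m = x)).card : ℝ))
    (V : X → Y → ℝ) :
    ∑ p : X × Y, P p.1 * V p.1 p.2 * codeTest e d p = (1 / (M : ℝ)) * ∑ y, V (e (d y)) y := by
  have hterm : ∀ x y, P x * V x y * codeTest e d (x, y) =
      if e (d y) = x then (1 / (M : ℝ)) * V x y else 0 := by
    intro x y
    unfold codeTest
    split_ifs with h
    · have hcard : ((Finset.univ.filter (fun m : Fin M => e m = x)).card : ℝ) ≠ 0 :=
        Nat.cast_ne_zero.mpr (Finset.card_ne_zero_of_mem (a := d y) (by simpa using h))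
      rw [hP]
      field_simp
    · simp
  rw [Fintype.sum_prod_type_right, Finset.mul_sum]
  simp [hterm]

lemma one_sub_avgErr {A B : Type*} [Fintype B] {M : ℕ} (V : A → B → ℝ)
    (e : Fin M → A) (d : B → Fin M) :
    1 - avgErr V e d = (1 / (M : ℝ)) * ∑ b, V (e (d b)) b := by
  have hsum : ∑ m : Fin M, ∑ b ∈ Finset.univ.filter (fun b => d b = m), V (e m) b =
      ∑ b, V (e (d b)) b := by
    rw [← Finset.sum_fiberwise Finset.univ d]
    refine Finset.sum_congr rfl fun m _ => Finset.sum_congr rfl fun b hb => ?_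
    rw [(Finset.mem_filter.mp hb).2]
  rw [avgErr, hsum, sub_sub_cancel]

/-- If `(e,d)` is an `M`-message code for `W` with average error
probability at most `ε`, and `P` is the input distribution induced by a uniform message,
then for every output distribution `Q`, `D_h^ε(P × W ‖ P × Q) ≥ log M + log(1-ε)`. -/
theorem Dh_ge_log_M
    {X Y : Type*} [Fintype X] [Fintype Y] [DecidableEq X]
    (W : X → Y → ℝ) (hW : IsChannel W) (M : ℕ) (hM : 1 ≤ M)
    (e : Fin M → X) (d : Y → Fin M) (ε : ℝ) (hε : ε ∈ Set.Ioo (0 : ℝ) 1)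
    (herr : avgErr W e d ≤ ε)
    (P : X → ℝ)
    (hP : ∀ x, P x = (1 / (M : ℝ)) * ((Finset.univ.filter (fun m : Fin M => e m = x)).card : ℝ))
    (Q : Y → ℝ) (hQ : IsDist Q) :
    ((Real.log M + Real.log (1 - ε) : ℝ) : EReal) ≤
      Dh ε (fun p : X × Y => P p.1 * W p.1 p.2) (fun p : X × Y => P p.1 * Q p.2) := by
  have hM' : (0 : ℝ) < M := by exact_mod_cast hM
  have hε' : 0 < 1 - ε := sub_pos.mpr hε.2
  refine le_sSup ⟨_, ⟨codeTest e d, codeTest_mem_Icc e d, ?_, ?_⟩, rfl⟩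
  · rw [sum_mul_codeTest e d P hP (fun _ => Q), hQ.2, ← Real.log_mul hM'.ne' hε'.ne',
      Real.exp_neg, Real.exp_log (mul_pos hM' hε')]
    field_simp
    exact le_rfl
  · rw [sum_mul_codeTest e d P hP W, ← one_sub_avgErr]
    linarith
end

section
/- Let Y be a finite set with |Y| ≥ 2, let Q₀ be a probability distribution on Y, let n ≥ 1, and set ζ := |Y|·(|Y|−1). Define K := { k ∈ ℤ^Y | Σ_y k_y = 0 and k_y ≥ −Q₀(y)·√(nζ) for all y } and, for k ∈ K, the probability distribution Q_k(y) := Q₀(y) + k_y/√(nζ). Then the points {Q_k}_{k∈K} form a (1/√n)-net of the probability simplex on Y in Euclidean norm: for every probability distribution Q on Y there exists k ∈ K such that ‖Q − Q_k‖₂ ≤ 1/√n. -/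
open Finset

/-- An integer `t` between `∑ L` and `∑ U` is the sum of an integer vector in the box `[L, U]`. -/
theorem exists_int_sum_eq_of_mem_box {ι : Type*} (s : Finset ι) (L U : ι → ℤ)
    (hLU : ∀ i, L i ≤ U i) (t : ℤ) (hL : ∑ i ∈ s, L i ≤ t) (hU : t ≤ ∑ i ∈ s, U i) :
    ∃ k : ι → ℤ, (∀ i, L i ≤ k i ∧ k i ≤ U i) ∧ ∑ i ∈ s, k i = t := by
  classical
  induction s using Finset.induction_on generalizing t with
  | empty =>
    simp only [Finset.sum_empty] at hL hU
    exact ⟨L, fun i => ⟨le_rfl, hLU i⟩, by simp; omega⟩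
  | insert a s ha ih =>
    rw [Finset.sum_insert ha] at hL hU
    have hs : ∑ i ∈ s, L i ≤ ∑ i ∈ s, U i := Finset.sum_le_sum fun i _ => hLU i
    have haLU := hLU a
    obtain ⟨k, hk, hsum⟩ := ih (t - max (L a) (t - ∑ i ∈ s, U i)) (by omega) (by omega)
    refine ⟨Function.update k a (max (L a) (t - ∑ i ∈ s, U i)), fun i => ?_, ?_⟩
    · by_cases h : i = a
      · subst h
        rw [Function.update_self]
        omega
      · rw [Function.update_of_ne h]
        exact hk i
    · rw [Finset.sum_insert ha, Function.update_self, Finset.sum_update_of_notMem ha, hsum]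
      omega

/-- A real vector with zero sum and all coordinates at most `1` has squared Euclidean norm at most
`|ι| (|ι| - 1)`. -/
theorem sum_sq_le_card_mul_of_le_one {ι : Type*} [Fintype ι] (e : ι → ℝ)
    (he : ∀ i, e i ≤ 1) (hsum : ∑ i, e i = 0) :
    ∑ i, e i ^ 2 ≤ (Fintype.card ι : ℝ) * ((Fintype.card ι : ℝ) - 1) := by
  have h := Finset.sum_sq_le_sq_sum_of_nonneg (s := Finset.univ) (f := fun i => 1 - e i)
    fun i _ => sub_nonneg.2 (he i)
  have h₁ : ∑ i, (1 - e i) = Fintype.card ι := by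
    simp [Finset.sum_sub_distrib, hsum]
  have h₂ : ∑ i, (1 - e i) ^ 2 = Fintype.card ι + ∑ i, e i ^ 2 := by
    calc ∑ i, (1 - e i) ^ 2 = ∑ i, (1 - 2 * e i + e i ^ 2) :=
          Finset.sum_congr rfl fun i _ => by ring
      _ = _ := by
          simp [Finset.sum_add_distrib, Finset.sum_sub_distrib, ← Finset.mul_sum, hsum]
  rw [h₁, h₂] at h
  linarith

/-- Let `|Y| ≥ 2`, `Q₀` a distribution on `Y`, `n ≥ 1` and
`ζ = |Y|(|Y|-1)`. The quantized points `Q_k(y) = Q₀(y) + k_y/√(nζ)`, for integer vectors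
`k` with `Σ_y k_y = 0` and `k_y ≥ -Q₀(y)√(nζ)`, form a `(1/√n)`-net of the probability
simplex on `Y` in the Euclidean norm. -/
theorem quantization_net
    {Y : Type*} [Fintype Y] (hY : 2 ≤ Fintype.card Y)
    (Q₀ : Y → ℝ) (hQ₀ : IsDist Q₀) (n : ℕ) (hn : 1 ≤ n) :
    ∀ Q : Y → ℝ, IsDist Q →
      ∃ k : Y → ℤ, (∑ y, k y = 0) ∧
        (∀ y, -(Q₀ y * Real.sqrt ((n : ℝ) * ((Fintype.card Y : ℝ) * ((Fintype.card Y : ℝ) - 1))))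
            ≤ (k y : ℝ)) ∧
        Real.sqrt (∑ y, (Q y - (Q₀ y + (k y : ℝ) /
            Real.sqrt ((n : ℝ) * ((Fintype.card Y : ℝ) * ((Fintype.card Y : ℝ) - 1))))) ^ 2)
          ≤ 1 / Real.sqrt n := by
  intro Q hQ
  have hm : (2 : ℝ) ≤ Fintype.card Y := by exact_mod_cast hY
  have hn₀ : (0 : ℝ) < n := by exact_mod_cast hn
  have hζ : (0 : ℝ) < (Fintype.card Y : ℝ) * ((Fintype.card Y : ℝ) - 1) :=
    mul_pos (by linarith) (by linarith)
  set ζ : ℝ := (Fintype.card Y : ℝ) * ((Fintype.card Y : ℝ) - 1)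
  set s : ℝ := Real.sqrt (n * ζ)
  have hs : 0 < s := Real.sqrt_pos.2 (mul_pos hn₀ hζ)
  have hs_sq : s ^ 2 = n * ζ := Real.sq_sqrt (mul_pos hn₀ hζ).le
  have hx_sum : ∑ y, s * (Q y - Q₀ y) = 0 := by
    rw [← Finset.mul_sum, Finset.sum_sub_distrib, hQ.2, hQ₀.2, sub_self, mul_zero]
  obtain ⟨k, hk, hk_sum⟩ := exists_int_sum_eq_of_mem_box Finset.univ
    (fun y => ⌈-(Q₀ y * s)⌉) (fun y => ⌈s * (Q y - Q₀ y)⌉)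
    (fun y => Int.ceil_mono (by nlinarith [mul_nonneg hs.le (hQ.1 y)])) 0
    (Finset.sum_nonpos fun y _ => Int.ceil_le.2 (by
      simpa using mul_nonneg (hQ₀.1 y) hs.le))
    (by
      have h : ∑ y, s * (Q y - Q₀ y) ≤ ∑ y, (⌈s * (Q y - Q₀ y)⌉ : ℝ) :=
        Finset.sum_le_sum fun y _ => Int.le_ceil _
      rw [hx_sum] at h
      exact_mod_cast h)
  refine ⟨k, hk_sum, fun y => Int.ceil_le.1 (hk y).1, ?_⟩
  have herr := sum_sq_le_card_mul_of_le_one (fun y => (k y : ℝ) - s * (Q y - Q₀ y))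
    (fun y => by
      have h₁ : (k y : ℝ) ≤ ⌈s * (Q y - Q₀ y)⌉ := by exact_mod_cast (hk y).2
      linarith [Int.ceil_lt_add_one (s * (Q y - Q₀ y))])
    (by
      rw [Finset.sum_sub_distrib, hx_sum, sub_zero]
      exact_mod_cast hk_sum)
  have hscale : ∑ y, (Q y - (Q₀ y + (k y : ℝ) / s)) ^ 2
      = (∑ y, ((k y : ℝ) - s * (Q y - Q₀ y)) ^ 2) / s ^ 2 := by
    rw [Finset.sum_div]
    refine Finset.sum_congr rfl fun y _ => ?_
    field_simp
    ring
  rw [hscale, one_div, ← Real.sqrt_inv, ← one_div]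
  refine Real.sqrt_le_sqrt ?_
  rw [hs_sq, div_le_div_iff₀ (mul_pos hn₀ hζ) hn₀]
  nlinarith
end

section
/- Let W be a discrete memoryless channel with finite input alphabet X and finite output alphabet Y such that every output is accessible (for every y there is x with W(y|x) > 0). Then there exist μ > 0 and α > 0 such that for every probability distribution P on X with min_{P'∈Π} ‖P − P'‖₂ ≤ μ, it holds that I(P,W) ≤ C − α·‖P − P*‖₂², where P* := argmin_{P'∈Π} ‖P − P'‖₂ is the Euclidean projection of P onto Π. -/
open Finset MeasureTheory

/-- Output distribution `PW`. -/
noncomputable def outDist {X Y : Type*} [Fintype X] (P : X → ℝ) (W : X → Y → ℝ) (y : Y) : ℝ :=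
  ∑ x, P x * W x y

/-- Mutual information `I(P,W) = Σ_x P(x) D(W(·|x)‖PW)`. -/
noncomputable def mutInfo {X Y : Type*} [Fintype X] [Fintype Y] (P : X → ℝ) (W : X → Y → ℝ) : ℝ :=
  ∑ x, P x * relEnt (W x) (outDist P W)

/-- Channel capacity `C = max_P I(P,W)`. -/
noncomputable def capacity {X Y : Type*} [Fintype X] [Fintype Y] (W : X → Y → ℝ) : ℝ :=
  sSup {c : ℝ | ∃ P : X → ℝ, IsDist P ∧ c = mutInfo P W}

/-- `P` is a capacity-achieving input distribution (member of `Π`). -/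
def isCAID {X Y : Type*} [Fintype X] [Fintype Y] (W : X → Y → ℝ) (P : X → ℝ) : Prop :=
  IsDist P ∧ mutInfo P W = capacity W

/-- Conditional information variance `V(P,W) = Σ_x P(x) V(W(·|x)‖PW)`. -/
noncomputable def infoVar {X Y : Type*} [Fintype X] [Fintype Y] (P : X → ℝ) (W : X → Y → ℝ) : ℝ :=
  ∑ x, P x * divVar (W x) (outDist P W)

/-- `V_min = min_{P ∈ Π} V(P,W)`. -/
noncomputable def Vmin {X Y : Type*} [Fintype X] [Fintype Y] (W : X → Y → ℝ) : ℝ :=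
  sInf {v : ℝ | ∃ P : X → ℝ, isCAID W P ∧ v = infoVar P W}

/-- `V_max = max_{P ∈ Π} V(P,W)`. -/
noncomputable def Vmax {X Y : Type*} [Fintype X] [Fintype Y] (W : X → Y → ℝ) : ℝ :=
  sSup {v : ℝ | ∃ P : X → ℝ, isCAID W P ∧ v = infoVar P W}

/-- The `ε`-channel dispersion `V_ε`. -/
noncomputable def Veps {X Y : Type*} [Fintype X] [Fintype Y] (W : X → Y → ℝ) (ε : ℝ) : ℝ :=
  if ε < 1/2 then Vmin W else Vmax W

/-- Euclidean norm of the difference of two functions on a finite set. -/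
noncomputable def dist2 {Z : Type*} [Fintype Z] (P Q : Z → ℝ) : ℝ :=
  Real.sqrt (∑ z, (P z - Q z) ^ 2)

section PolyhedralErrorBound

variable {X ι : Type*} [Fintype X]

lemma outDist_smul (c : ℝ) (h : X → ℝ) (A : X → ι → ℝ) (i : ι) :
    outDist (fun x => c * h x) A i = c * outDist h A i := by
  simp only [outDist, Finset.mul_sum, mul_assoc]

lemma outDist_sub (P Q : X → ℝ) (A : X → ι → ℝ) (i : ι) :
    outDist (fun x => P x - Q x) A i = outDist P A i - outDist Q A i := by
  simp only [outDist, sub_mul, Finset.sum_sub_distrib]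

lemma outDist_add_smul (P d : X → ℝ) (t : ℝ) (A : X → ι → ℝ) (i : ι) :
    outDist (fun x => P x + t * d x) A i = outDist P A i + t * outDist d A i := by
  simp only [outDist, add_mul, Finset.sum_add_distrib, Finset.mul_sum, mul_assoc]

/-- On the cone of vectors that are nonnegative on `S` and normal to the kernel of `A` within that
cone, the linear map `A` is bounded below. -/
lemma exists_lower_bound_of_normal [Fintype ι] (A : X → ι → ℝ) (S : Set X) :
    ∃ κ > (0 : ℝ), ∀ h : X → ℝ, (∀ x ∈ S, 0 ≤ h x) →
      (∀ d : X → ℝ, (∀ i, outDist d A i = 0) → (∀ x ∈ S, 0 ≤ d x) → ∑ x, h x * d x ≤ 0) →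
      κ * ∑ x, h x ^ 2 ≤ ∑ i, outDist h A i ^ 2 := by
  set K : Set (X → ℝ) := {h | ∑ x, h x ^ 2 = 1 ∧ (∀ x ∈ S, 0 ≤ h x) ∧
    ∀ d : X → ℝ, (∀ i, outDist d A i = 0) → (∀ x ∈ S, 0 ≤ d x) → ∑ x, h x * d x ≤ 0} with hK
  have hclosed : IsClosed K := by
    simp only [hK, Set.ofPred_and, Set.ofPred_forall]
    refine (isClosed_eq (by fun_prop) (by fun_prop)).inter (IsClosed.inter ?_ ?_)
    · exact isClosed_iInter fun x => isClosed_iInter fun _ =>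
        isClosed_le (by fun_prop) (by fun_prop)
    · exact isClosed_iInter fun d => isClosed_iInter fun _ => isClosed_iInter fun _ =>
        isClosed_le (by fun_prop) (by fun_prop)
  have hcompact : IsCompact K := by
    refine (isCompact_Icc (a := fun _ : X => (-1 : ℝ)) (b := fun _ => 1)).of_isClosed_subset
      hclosed fun h hh => ?_
    have hx (x : X) : h x ^ 2 ≤ 1 :=
      hh.1 ▸ Finset.single_le_sum (f := fun x => h x ^ 2) (fun _ _ => sq_nonneg _)
        (Finset.mem_univ x)
    exact ⟨fun x => by have := hx x; dsimp only; nlinarith,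
      fun x => by have := hx x; dsimp only; nlinarith⟩
  have hpos (h : X → ℝ) (hh : h ∈ K) : 0 < ∑ i, outDist h A i ^ 2 := by
    by_contra! hle
    have hz : ∀ i, outDist h A i = 0 := fun i => by
      have := (Finset.sum_eq_zero_iff_of_nonneg (fun i _ => sq_nonneg (outDist h A i))).1
        (le_antisymm hle (Finset.sum_nonneg fun i _ => sq_nonneg _)) i (Finset.mem_univ i)
      exact pow_eq_zero_iff (two_ne_zero) |>.1 this
    have h1 := hh.2.2 h hz hh.2.1
    have h2 := hh.1
    simp only [pow_two] at h2
    linarith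
  have hunit : ∃ κ > (0 : ℝ), ∀ h ∈ K, κ ≤ ∑ i, outDist h A i ^ 2 := by
    rcases K.eq_empty_or_nonempty with he | hne
    · exact ⟨1, one_pos, by simp [he]⟩
    · obtain ⟨m, hm, hmin⟩ := hcompact.exists_isMinOn hne
        (f := fun h => ∑ i, outDist h A i ^ 2) (by unfold outDist; fun_prop)
      exact ⟨_, hpos m hm, fun h hh => hmin hh⟩
  obtain ⟨κ, hκ, hbound⟩ := hunit
  refine ⟨κ, hκ, fun h hS hn => ?_⟩
  rcases (Finset.sum_nonneg fun x _ => sq_nonneg (h x) : 0 ≤ ∑ x, h x ^ 2).eq_or_lt with h0 | h0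
  · rw [← h0, mul_zero]
    exact Finset.sum_nonneg fun i _ => sq_nonneg _
  · set s := ∑ x, h x ^ 2 with hs
    have hsq : (√s)⁻¹ ^ 2 = s⁻¹ := by rw [inv_pow, Real.sq_sqrt h0.le]
    have hmem : (fun x => (√s)⁻¹ * h x) ∈ K := by
      refine ⟨?_, fun x hx => mul_nonneg (by positivity) (hS x hx), fun d hd hdS => ?_⟩
      · simp only [mul_pow, ← Finset.mul_sum, hsq]
        exact inv_mul_cancel₀ h0.ne'
      · simp only [mul_assoc, ← Finset.mul_sum]
        exact mul_nonpos_of_nonneg_of_nonpos (by positivity) (hn d hd hdS)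
    have := hbound _ hmem
    simp only [outDist_smul, mul_pow, ← Finset.mul_sum, hsq] at this
    rwa [inv_mul_eq_div, le_div_iff₀ h0] at this

lemma exists_pos_add_smul_nonneg {P d : X → ℝ} (hP : ∀ x, 0 ≤ P x)
    (hd : ∀ x, P x = 0 → 0 ≤ d x) :
    ∃ r > (0 : ℝ), ∀ t, 0 ≤ t → t ≤ r → ∀ x, 0 ≤ P x + t * d x := by
  have hx (x : X) : ∃ r > (0 : ℝ), ∀ t, 0 ≤ t → t ≤ r → 0 ≤ P x + t * d x := by
    rcases (hP x).eq_or_lt with h0 | h0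
    · exact ⟨1, one_pos, fun t ht _ => by
        rw [← h0, zero_add]; exact mul_nonneg ht (hd x h0.symm)⟩
    · refine ⟨P x / (1 + |d x|), by positivity, fun t ht hr => ?_⟩
      rw [le_div_iff₀ (by positivity)] at hr
      nlinarith [neg_abs_le (d x)]
  choose r hr hrx using hx
  cases isEmpty_or_nonempty X
  · exact ⟨1, one_pos, fun _ _ _ x => isEmptyElim x⟩
  · obtain ⟨m, hm⟩ := Finite.exists_min r
    exact ⟨r m, hr m, fun t ht htr x => hrx x t ht (htr.trans (hm x))⟩

lemma dist2_sq (P Q : X → ℝ) : dist2 P Q ^ 2 = ∑ x, (P x - Q x) ^ 2 :=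
  Real.sq_sqrt (Finset.sum_nonneg fun _ _ => sq_nonneg _)

/-- The Hoffman error bound for the polyhedron `{Q ≥ 0 | Q A = b}`, in terms of the Euclidean
projection `Pstar` of a nonnegative vector `P`. -/
lemma exists_hoffman_bound [Fintype ι] (A : X → ι → ℝ) :
    ∃ κ > (0 : ℝ), ∀ P Pstar : X → ℝ, (∀ x, 0 ≤ P x) → (∀ x, 0 ≤ Pstar x) →
      (∀ P' : X → ℝ, (∀ x, 0 ≤ P' x) → (∀ i, outDist P' A i = outDist Pstar A i) →
        dist2 P Pstar ≤ dist2 P P') →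
      κ * dist2 P Pstar ^ 2 ≤ ∑ i, (outDist P A i - outDist Pstar A i) ^ 2 := by
  choose κ hκ hbound using exists_lower_bound_of_normal A
  obtain ⟨S₀, hS₀⟩ := Finite.exists_min κ
  refine ⟨κ S₀, hκ S₀, fun P Pstar hP hPs hmin => ?_⟩
  have key := hbound {x | Pstar x = 0} (fun x => P x - Pstar x)
    (fun x hx => by rw [Set.mem_ofPred_eq] at hx; simpa [hx] using hP x) (fun d hd hdS => ?_)
  · simp only [outDist_sub] at key
    rw [dist2_sq]
    exact (mul_le_mul_of_nonneg_right (hS₀ _)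
      (Finset.sum_nonneg fun _ _ => sq_nonneg _)).trans key
  · obtain ⟨r, hr, hrt⟩ := exists_pos_add_smul_nonneg hPs hdS
    by_contra! ha
    set a := ∑ x, (P x - Pstar x) * d x with ha'
    set b := ∑ x, d x ^ 2 with hb'
    have hb : 0 ≤ b := Finset.sum_nonneg fun _ _ => sq_nonneg _
    set t := min r (a / (b + 1)) with ht'
    have ht : 0 < t := lt_min hr (by positivity)
    have htb : t * (b + 1) ≤ a := (le_div_iff₀ (by positivity)).1 (min_le_right _ _)
    have hle := hmin (fun x => Pstar x + t * d x) (hrt t ht.le (min_le_left _ _))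
      (fun i => by rw [outDist_add_smul, hd, mul_zero, add_zero])
    have hsq := pow_le_pow_left₀ (show 0 ≤ dist2 P Pstar from Real.sqrt_nonneg _) hle 2
    have hexp : ∑ x, (P x - (Pstar x + t * d x)) ^ 2
        = ∑ x, (P x - Pstar x) ^ 2 - 2 * t * a + t ^ 2 * b := by
      rw [ha', hb', Finset.mul_sum, Finset.mul_sum, ← Finset.sum_sub_distrib,
        ← Finset.sum_add_distrib]
      exact Finset.sum_congr rfl fun x _ => by ring
    rw [dist2_sq, dist2_sq, hexp] at hsq
    nlinarith

end PolyhedralErrorBound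

section Information

variable {X Y : Type*} [Fintype X] [Fintype Y]

lemma IsDist.le_one {P : X → ℝ} (hP : IsDist P) (x : X) : P x ≤ 1 :=
  hP.2 ▸ Finset.single_le_sum (fun x _ => hP.1 x) (Finset.mem_univ x)

lemma sum_outDist {W : X → Y → ℝ} (hW : IsChannel W) (P : X → ℝ) :
    ∑ y, outDist P W y = ∑ x, P x := by
  simp only [outDist]
  rw [Finset.sum_comm]
  exact Finset.sum_congr rfl fun x _ => by rw [← Finset.mul_sum, (hW x).2, mul_one]

lemma mul_le_outDist {W : X → Y → ℝ} (hW : IsChannel W) {P : X → ℝ} (hP : IsDist P)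
    (x : X) (y : Y) : P x * W x y ≤ outDist P W y :=
  Finset.single_le_sum (f := fun x => P x * W x y)
    (fun x _ => mul_nonneg (hP.1 x) ((hW x).1 y)) (Finset.mem_univ x)

lemma isDist_outDist {W : X → Y → ℝ} (hW : IsChannel W) {P : X → ℝ} (hP : IsDist P) :
    IsDist (outDist P W) :=
  ⟨fun y => Finset.sum_nonneg fun x _ => mul_nonneg (hP.1 x) ((hW x).1 y),
    (sum_outDist hW P).trans hP.2⟩

lemma sub_add_sq_le_mul_log_div {p q : ℝ} (hp : 0 ≤ p) (hp1 : p ≤ 1) (hq : 0 ≤ q) (hq1 : q ≤ 1)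
    (hpq : q = 0 → p = 0) : p - q + (p - q) ^ 2 / 4 ≤ p * Real.log (p / q) := by
  rcases hp.eq_or_lt with rfl | hp
  · rw [zero_mul]; nlinarith
  have hq : 0 < q := hq.lt_of_ne fun h => hp.ne' (hpq h.symm)
  set u := √p with hu
  set v := √q with hv
  have hu0 : 0 < u := Real.sqrt_pos.2 hp
  have hv0 : 0 < v := Real.sqrt_pos.2 hq
  have hup : u ^ 2 = p := Real.sq_sqrt hp.le
  have hvq : v ^ 2 = q := Real.sq_sqrt hq.le
  have hu1 : u ≤ 1 := by nlinarith
  have hv1 : v ≤ 1 := by nlinarith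
  rw [← hup, ← hvq, ← div_pow, Real.log_pow]
  have hlog := Real.one_sub_inv_le_log_of_pos (div_pos hu0 hv0)
  rw [inv_div] at hlog
  have hmul : u ^ 2 - u * v ≤ u ^ 2 * Real.log (u / v) := by
    have := mul_le_mul_of_nonneg_left hlog (sq_nonneg u)
    have he : u ^ 2 * (1 - v / u) = u ^ 2 - u * v := by field_simp
    linarith
  have hsq : (u ^ 2 - v ^ 2) ^ 2 ≤ 4 * (u - v) ^ 2 := by
    have he : (u ^ 2 - v ^ 2) ^ 2 = (u + v) ^ 2 * (u - v) ^ 2 := by ring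
    rw [he]
    exact mul_le_mul_of_nonneg_right (by nlinarith) (sq_nonneg _)
  push_cast
  nlinarith

/-- A Pinsker-type inequality in the Euclidean norm. -/
lemma sum_sq_sub_le_relEnt {P Q : Y → ℝ} (hP : IsDist P) (hQ : IsDist Q)
    (hPQ : ∀ y, Q y = 0 → P y = 0) : (∑ y, (P y - Q y) ^ 2) / 4 ≤ relEnt P Q := by
  have h := Finset.sum_le_sum fun y (_ : y ∈ Finset.univ) =>
    sub_add_sq_le_mul_log_div (hP.1 y) (hP.le_one y) (hQ.1 y) (hQ.le_one y) (hPQ y)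
  rw [Finset.sum_add_distrib, Finset.sum_sub_distrib, hP.2, hQ.2, ← Finset.sum_div] at h
  unfold relEnt
  linarith

lemma relEnt_nonneg {P Q : Y → ℝ} (hP : IsDist P) (hQ : IsDist Q)
    (hPQ : ∀ y, Q y = 0 → P y = 0) : 0 ≤ relEnt P Q :=
  (div_nonneg (Finset.sum_nonneg fun _ _ => sq_nonneg _) (by norm_num)).trans
    (sum_sq_sub_le_relEnt hP hQ hPQ)

/-- The compensation identity `Σ_x P(x) D(W(·|x)‖Q) = I(P,W) + D(PW‖Q)`. -/
lemma sum_mul_relEnt_eq {W : X → Y → ℝ} (hW : IsChannel W) {P : X → ℝ} (hP : IsDist P)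
    {Q : Y → ℝ} (hPQ : ∀ y, Q y = 0 → outDist P W y = 0) :
    ∑ x, P x * relEnt (W x) Q = mutInfo P W + relEnt (outDist P W) Q := by
  have hR : relEnt (outDist P W) Q
      = ∑ x, ∑ y, P x * (W x y * Real.log (outDist P W y / Q y)) := by
    rw [Finset.sum_comm]
    refine Finset.sum_congr rfl fun y _ => ?_
    conv_lhs => enter [1]; unfold outDist
    rw [Finset.sum_mul]
    exact Finset.sum_congr rfl fun x _ => mul_assoc _ _ _
  rw [hR, mutInfo, ← Finset.sum_add_distrib]
  refine Finset.sum_congr rfl fun x _ => ?_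
  rw [relEnt, relEnt, Finset.mul_sum, Finset.mul_sum, ← Finset.sum_add_distrib]
  refine Finset.sum_congr rfl fun y _ => ?_
  rcases (hP.1 x).eq_or_lt with h0 | hPx
  · simp [← h0]
  rcases ((hW x).1 y).eq_or_lt with h0 | hWxy
  · simp [← h0]
  have hO : outDist P W y ≠ 0 := ((mul_pos hPx hWxy).trans_le (mul_le_outDist hW hP x y)).ne'
  have hQ : Q y ≠ 0 := fun h => hO (hPQ y h)
  rw [Real.log_div hWxy.ne' hQ, Real.log_div hWxy.ne' hO, Real.log_div hO hQ]
  ring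

lemma mutInfo_le_card {W : X → Y → ℝ} (hW : IsChannel W) {P : X → ℝ} (hP : IsDist P) :
    mutInfo P W ≤ Fintype.card X := by
  have hx (x : X) : P x * relEnt (W x) (outDist P W) ≤ 1 := by
    rw [relEnt, Finset.mul_sum, ← (hW x).2]
    refine Finset.sum_le_sum fun y _ => ?_
    rcases (hP.1 x).eq_or_lt with h0 | hPx
    · simpa [← h0] using (hW x).1 y
    rcases ((hW x).1 y).eq_or_lt with h0 | hWxy
    · simp [← h0]
    have hle := mul_le_outDist hW hP x y
    have hO : 0 < outDist P W y := (mul_pos hPx hWxy).trans_le hle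
    have hlog := Real.log_le_sub_one_of_pos (div_pos hWxy hO)
    have h1 : P x * (W x y / outDist P W y) ≤ 1 := by
      rw [← mul_div_assoc, div_le_one hO]; exact hle
    have h2 : P x * Real.log (W x y / outDist P W y) ≤ 1 := by nlinarith
    calc P x * (W x y * Real.log (W x y / outDist P W y))
        = W x y * (P x * Real.log (W x y / outDist P W y)) := by ring
      _ ≤ W x y * 1 := mul_le_mul_of_nonneg_left h2 hWxy.le
      _ = W x y := mul_one _
  calc mutInfo P W ≤ ∑ _x : X, (1 : ℝ) := Finset.sum_le_sum fun x _ => hx x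
    _ = Fintype.card X := by simp

lemma mutInfo_le_capacity {W : X → Y → ℝ} (hW : IsChannel W) {P : X → ℝ} (hP : IsDist P) :
    mutInfo P W ≤ capacity W :=
  le_csSup ⟨Fintype.card X, by rintro _ ⟨P, hP, rfl⟩; exact mutInfo_le_card hW hP⟩ ⟨P, hP, rfl⟩

lemma relEnt_mix_le_capacity {W : X → Y → ℝ} (hW : IsChannel W) {P : X → ℝ} (hP : isCAID W P)
    (x : X) {t : ℝ} (ht : 0 < t) (ht1 : t < 1) :
    relEnt (W x) (fun y => outDist P W y + t * (W x y - outDist P W y)) ≤ capacity W := by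
  classical
  set e : X → ℝ := Pi.single x 1 with he
  have he0 (z : X) : 0 ≤ e z := by
    rw [he, Pi.single_apply]; split_ifs <;> norm_num
  have he1 : ∑ z, e z = 1 := by simp [he]
  have hesum (f : X → ℝ) : ∑ z, e z * f z = f x := by simp [he, Pi.single_apply]
  set R : X → ℝ := fun z => P z + t * (e z - P z) with hR
  have hRd : IsDist R := by
    refine ⟨fun z => ?_, ?_⟩
    · have h1 := mul_nonneg ht.le (he0 z)
      have h2 := mul_nonneg (sub_nonneg.2 ht1.le) (hP.1.1 z)
      simp only [hR]; linarith
    · simp only [hR, Finset.sum_add_distrib, ← Finset.mul_sum, Finset.sum_sub_distrib, he1, hP.1.2]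
      ring
  have hout : outDist R W = fun y => outDist P W y + t * (W x y - outDist P W y) := by
    funext y
    rw [hR, outDist_add_smul, outDist_sub]
    congr 3
    exact hesum fun z => W z y
  rw [← hout]
  have hsupp : ∀ y, outDist R W y = 0 → outDist P W y = 0 := fun y hy => by
    have h1 := (isDist_outDist hW hP.1).1 y
    have h2 := (hW x).1 y
    rw [hout] at hy
    simp only at hy
    have h3 := mul_nonneg ht.le h2
    have h4 := mul_nonneg (sub_pos.2 ht1).le h1
    have h5 : (1 - t) * outDist P W y = 0 := by linarith
    exact (mul_eq_zero.1 h5).resolve_left (sub_pos.2 ht1).ne'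
  have hcomp := sum_mul_relEnt_eq hW hP.1 hsupp
  have hnn := relEnt_nonneg (isDist_outDist hW hP.1) (isDist_outDist hW hRd) hsupp
  have hRC := mutInfo_le_capacity hW hRd
  have hRI : mutInfo R W = (1 - t) * ∑ z, P z * relEnt (W z) (outDist R W)
      + t * relEnt (W x) (outDist R W) := by
    rw [← hesum fun z => relEnt (W z) (outDist R W), mutInfo, Finset.mul_sum, Finset.mul_sum,
      ← Finset.sum_add_distrib]
    exact Finset.sum_congr rfl fun z _ => by simp only [hR]; ring
  rw [hcomp, hP.2] at hRI
  have h6 := mul_nonneg (sub_pos.2 ht1).le hnn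
  have h7 : t * relEnt (W x) (outDist R W) ≤ t * capacity W := by linarith
  exact le_of_mul_le_mul_left h7 ht

lemma isCAID.outDist_pos {W : X → Y → ℝ} (hW : IsChannel W) (hacc : ∀ y, ∃ x, 0 < W x y)
    {P : X → ℝ} (hP : isCAID W P) (y : Y) : 0 < outDist P W y := by
  classical
  refine ((isDist_outDist hW hP.1).1 y).lt_of_ne fun h0 => ?_
  obtain ⟨x, hx⟩ := hacc y
  have hbound (s : ℝ) (hs : 0 < s) : W x y * s - Fintype.card Y ≤ capacity W := by
    have ht := Real.exp_pos (-s)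
    have ht1 : Real.exp (-s) < 1 := by simpa using hs
    refine le_trans ?_ (relEnt_mix_le_capacity hW hP x ht ht1)
    set t := Real.exp (-s) with hts
    set Q : Y → ℝ := fun y => outDist P W y + t * (W x y - outDist P W y) with hQ
    have hterm (z : Y) : -1 ≤ W x z * Real.log (W x z / Q z) := by
      rcases ((hW x).1 z).eq_or_lt with h | h
      · simp [← h]
      have h1 := mul_nonneg (sub_pos.2 ht1).le ((isDist_outDist hW hP.1).1 z)
      have h1' := mul_le_mul_of_nonneg_left ((isDist_outDist hW hP.1).le_one z) (sub_pos.2 ht1).le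
      have h2 := mul_pos ht h
      have h2' := mul_le_mul_of_nonneg_left ((hW x).le_one z) ht.le
      have hQz : 0 < Q z := by simp only [hQ]; linarith
      have hQ1 : Q z ≤ 1 := by simp only [hQ]; linarith
      have := sub_add_sq_le_mul_log_div h.le ((hW x).le_one z) hQz.le hQ1
        (fun h => absurd h hQz.ne')
      nlinarith [sq_nonneg (W x z - Q z)]
    have hy : W x y * Real.log (W x y / Q y) = W x y * s := by
      have : W x y / Q y = Real.exp s := by
        simp only [hQ, ← h0, zero_add, sub_zero, hts, Real.exp_neg]
        field_simp
      rw [this, Real.log_exp]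
    rw [relEnt, ← Finset.add_sum_erase _ _ (Finset.mem_univ y), hy]
    have hrest : ∑ _z ∈ Finset.univ.erase y, (-1 : ℝ)
        ≤ ∑ z ∈ Finset.univ.erase y, W x z * Real.log (W x z / Q z) :=
      Finset.sum_le_sum fun z _ => hterm z
    have hcard : -(Fintype.card Y : ℝ) ≤ ∑ _z ∈ Finset.univ.erase y, (-1 : ℝ) := by
      rw [Finset.sum_const, nsmul_eq_mul, mul_neg_one, neg_le_neg_iff]
      exact_mod_cast (Finset.card_erase_le.trans_eq Finset.card_univ)
    linarith
  have := hbound ((|capacity W| + Fintype.card Y + 1) / W x y) (by positivity)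
  rw [mul_div_cancel₀ _ hx.ne'] at this
  linarith [le_abs_self (capacity W)]

/-- The Kuhn–Tucker condition at a capacity-achieving input distribution. -/
lemma isCAID.relEnt_le_capacity {W : X → Y → ℝ} (hW : IsChannel W)
    (hacc : ∀ y, ∃ x, 0 < W x y) {P : X → ℝ} (hP : isCAID W P) (x : X) :
    relEnt (W x) (outDist P W) ≤ capacity W := by
  have hlim : Filter.Tendsto
      (fun t : ℝ => relEnt (W x) (fun y => outDist P W y + t * (W x y - outDist P W y)))
      (nhdsWithin 0 (Set.Ioi 0)) (nhds (relEnt (W x) (outDist P W))) := by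
    unfold relEnt
    refine tendsto_finsetSum _ fun y _ => ?_
    rcases ((hW x).1 y).eq_or_lt with h | h
    · simp [← h]
    have hQ := hP.outDist_pos hW hacc y
    have hc : ContinuousAt (fun t : ℝ => W x y * Real.log
        (W x y / (outDist P W y + t * (W x y - outDist P W y)))) 0 := by
      have h1 : outDist P W y + 0 * (W x y - outDist P W y) ≠ 0 := by simpa using hQ.ne'
      refine continuousAt_const.mul (ContinuousAt.log (continuousAt_const.div (by fun_prop) h1) ?_)
      exact div_ne_zero h.ne' h1
    have := hc.tendsto.mono_left (nhdsWithin_le_nhds (s := Set.Ioi 0))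
    simpa using this
  refine le_of_tendsto hlim ?_
  filter_upwards [Ioo_mem_nhdsGT (zero_lt_one (α := ℝ))] with t ht
  exact relEnt_mix_le_capacity hW hP x ht.1 ht.2

/-- A reference capacity-achieving distribution describes the whole set of such distributions by
linear equations on the simplex. -/
lemma isCAID_iff_of_isCAID {W : X → Y → ℝ} (hW : IsChannel W) (hacc : ∀ y, ∃ x, 0 < W x y)
    {P₀ : X → ℝ} (hP₀ : isCAID W P₀) {P : X → ℝ} (hP : IsDist P) :
    isCAID W P ↔ (∀ y, outDist P W y = outDist P₀ W y) ∧
      ∑ x, P x * relEnt (W x) (outDist P₀ W) = capacity W := by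
  have hsupp : ∀ y, outDist P₀ W y = 0 → outDist P W y = 0 :=
    fun y h => absurd h (hP₀.outDist_pos hW hacc y).ne'
  have hcomp := sum_mul_relEnt_eq hW hP hsupp
  have hpin := sum_sq_sub_le_relEnt (isDist_outDist hW hP) (isDist_outDist hW hP₀.1) hsupp
  have hsq : 0 ≤ ∑ y, (outDist P W y - outDist P₀ W y) ^ 2 :=
    Finset.sum_nonneg fun _ _ => sq_nonneg _
  constructor
  · intro h
    have hle : ∑ x, P x * relEnt (W x) (outDist P₀ W) ≤ ∑ x, P x * capacity W :=
      Finset.sum_le_sum fun x _ =>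
        mul_le_mul_of_nonneg_left (hP₀.relEnt_le_capacity hW hacc x) (hP.1 x)
    rw [← Finset.sum_mul, hP.2, one_mul] at hle
    have hI := h.2
    refine ⟨fun y => ?_, by linarith⟩
    have h0 := (Finset.sum_eq_zero_iff_of_nonneg fun y _ => sq_nonneg _).1
      (le_antisymm (by linarith) hsq) y (Finset.mem_univ y)
    exact sub_eq_zero.1 (pow_eq_zero_iff two_ne_zero |>.1 h0)
  · rintro ⟨hout, hC⟩
    refine ⟨hP, ?_⟩
    have hself := sum_mul_relEnt_eq hW hP (Q := outDist P W) fun _ h => h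
    have h0 : relEnt (outDist P W) (outDist P W) = 0 := Finset.sum_eq_zero fun y _ => by
      rcases eq_or_ne (outDist P W y) 0 with h | h
      · simp [h]
      · simp [div_self h]
    rw [h0, add_zero, funext hout] at hself
    rw [← hself, hC]

end Information

/-- For a DMC `W` with all outputs accessible, there are `μ > 0` and
`α > 0` such that every distribution `P` within Euclidean distance `μ` of the set `Π` of
capacity-achieving input distributions satisfies `I(P,W) ≤ C - α ‖P - P*‖₂²`, where `P*`
is the Euclidean projection of `P` onto `Π`. -/
theorem mutInfo_quadratic_decay
    {X Y : Type*} [Fintype X] [Fintype Y] [Nonempty X] [Nonempty Y]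
    (W : X → Y → ℝ) (hW : IsChannel W) (hacc : ∀ y, ∃ x, 0 < W x y) :
    ∃ μ > (0 : ℝ), ∃ α > (0 : ℝ),
      ∀ P Pstar : X → ℝ, IsDist P → isCAID W Pstar →
        (∀ P' : X → ℝ, isCAID W P' → dist2 P Pstar ≤ dist2 P P') →
        dist2 P Pstar ≤ μ →
        mutInfo P W ≤ capacity W - α * (dist2 P Pstar) ^ 2 := by
  by_cases hex : ∃ P₀, isCAID W P₀
  swap
  · exact ⟨1, one_pos, 1, one_pos, fun P Pstar _ h => absurd ⟨Pstar, h⟩ hex⟩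
  obtain ⟨P₀, hP₀⟩ := hex
  set D : X → ℝ := fun x => relEnt (W x) (outDist P₀ W) with hD
  have hDC : ∀ x, D x ≤ capacity W := hP₀.relEnt_le_capacity hW hacc
  obtain ⟨κ, hκ, hbound⟩ := exists_hoffman_bound
    (fun x (i : Option Y) => i.elim (D x) (W x))
  set M := ∑ x, (capacity W - D x) with hM
  have hM0 : 0 ≤ M := Finset.sum_nonneg fun x _ => sub_nonneg.2 (hDC x)
  refine ⟨1, one_pos, κ / (M + 4), by positivity, fun P Pstar hP hPs hmin _ => ?_⟩
  have hPs' := (isCAID_iff_of_isCAID hW hacc hP₀ hPs.1).1 hPs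
  have hgrowth := hbound P Pstar hP.1 hPs.1.1 fun P' hP' hout => by
    have hoW (y : Y) : outDist P' W y = outDist Pstar W y := hout (some y)
    have hoD : ∑ x, P' x * D x = ∑ x, Pstar x * D x := hout none
    have hdist : IsDist P' := ⟨hP', by
      rw [← sum_outDist hW, Finset.sum_congr rfl fun y _ => hoW y, sum_outDist hW, hPs.1.2]⟩
    exact hmin P' ((isCAID_iff_of_isCAID hW hacc hP₀ hdist).2
      ⟨fun y => (hoW y).trans (hPs'.1 y), hoD.trans hPs'.2⟩)
  rw [Fintype.sum_option] at hgrowth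
  have hsupp : ∀ y, outDist P₀ W y = 0 → outDist P W y = 0 :=
    fun y h => absurd h (hP₀.outDist_pos hW hacc y).ne'
  have hcomp := sum_mul_relEnt_eq hW hP hsupp
  have hpin := sum_sq_sub_le_relEnt (isDist_outDist hW hP) (isDist_outDist hW hP₀.1) hsupp
  set ℓ := ∑ x, P x * (capacity W - D x) with hℓ
  have hℓeq : ℓ = capacity W - ∑ x, P x * D x := by
    simp only [hℓ, mul_sub, Finset.sum_sub_distrib, ← Finset.sum_mul, hP.2, one_mul]
  have hℓ0 : 0 ≤ ℓ := Finset.sum_nonneg fun x _ => mul_nonneg (hP.1 x) (sub_nonneg.2 (hDC x))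
  have hℓM : ℓ ≤ M := Finset.sum_le_sum fun x _ =>
    mul_le_of_le_one_left (sub_nonneg.2 (hDC x)) (hP.le_one x)
  have hgrowth' : κ * dist2 P Pstar ^ 2
      ≤ (∑ x, P x * D x - capacity W) ^ 2 + ∑ y, (outDist P W y - outDist P₀ W y) ^ 2 := by
    refine hgrowth.trans_eq ?_
    congr 1
    · rw [← hPs'.2]; rfl
    · exact Finset.sum_congr rfl fun y _ => by rw [← hPs'.1 y]; rfl
  set s := ∑ y, (outDist P W y - outDist P₀ W y) ^ 2 with hs
  have hs0 : 0 ≤ s := Finset.sum_nonneg fun _ _ => sq_nonneg _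
  have hsq : (∑ x, P x * D x - capacity W) ^ 2 = ℓ ^ 2 := by rw [hℓeq]; ring
  have hgap : ℓ + s / 4 ≤ capacity W - mutInfo P W := by
    simp only [hD] at hℓeq; linarith
  have hfinal : κ / (M + 4) * dist2 P Pstar ^ 2 ≤ ℓ + s / 4 := by
    rw [div_mul_eq_mul_div, div_le_iff₀ (by positivity)]
    nlinarith [mul_le_mul_of_nonneg_left hℓM hℓ0, mul_nonneg hs0 hM0]
  linarith
end
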